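/- arXiv:1609.06235 — 4 statements merged into one kernel-verified Lean document; each statement's English description precedes it below -/
import Mathlib

section
/- Let $f:\mathbb{D}\to\mathbb{C}$ be a bounded analytic function on the open unit disk, and let $\gamma_1,\gamma_2$ be paths in the disk from $-1$ to $1$ such that $\lim_{s\to 1^-} f(\gamma_1(s))$ and $\lim_{s\to 1^-} f(\gamma_2(s))$ both exist. Then the region between $\gamma_1$ and $\gamma_2$ is a convergence set for $f$ at $1$: that is, there exists $\zeta\in\mathbb{C}$ such that $f(z)\to\zeta$ as $z\to 1$ with $z$ ranging over the region between $\gamma_1$ and $\gamma_2$. -/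
open Set Metric Filter

/-- The region between two paths: points of the unit disk lying on either path's trace
or in a bounded connected component of the complement of the union of the traces. -/
def regionBetweenPaths (γ₁ γ₂ : ℝ → ℂ) : Set ℂ :=
  {z ∈ ball (0:ℂ) 1 |
    z ∈ γ₁ '' Icc 0 1 ∨ z ∈ γ₂ '' Icc 0 1 ∨
      (z ∈ (γ₁ '' Icc 0 1 ∪ γ₂ '' Icc 0 1)ᶜ ∧
        Bornology.IsBounded (connectedComponentIn ((γ₁ '' Icc 0 1 ∪ γ₂ '' Icc 0 1)ᶜ) z))}

/-- `z - a` has a continuous logarithm on `E`. -/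
def HasLogOn (E : Set ℂ) (a : ℂ) : Prop :=
  ∃ l : ℂ → ℂ, ContinuousOn l E ∧ ∀ z ∈ E, Complex.exp (l z) = z - a

lemma HasLogOn.step {E : Set ℂ} {a b : ℂ} (h : HasLogOn E a)
    (hab : ∀ z ∈ E, ‖a - b‖ < ‖z - a‖) : HasLogOn E b := by
  obtain ⟨l, hl, hle⟩ := h
  have hne : ∀ z ∈ E, z - a ≠ 0 := by
    intro z hz h0
    have := hab z hz
    rw [h0, norm_zero] at this
    exact absurd (norm_nonneg _) (not_le.2 this)
  have hsl : ∀ z ∈ E, (1 + (a - b) / (z - a)) ∈ Complex.slitPlane := by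
    intro z hz
    apply Complex.mem_slitPlane_of_norm_lt_one
    rw [norm_div, div_lt_one (norm_pos_iff.2 (hne z hz))]
    exact hab z hz
  refine ⟨fun z => l z + Complex.log (1 + (a - b) / (z - a)), ?_, ?_⟩
  · apply hl.add
    apply ContinuousOn.clog _ hsl
    apply ContinuousOn.add continuousOn_const
    exact ContinuousOn.div continuousOn_const (by fun_prop) hne
  · intro z hz
    have := hne z hz
    rw [Complex.exp_add, Complex.exp_log (Complex.slitPlane_ne_zero (hsl z hz)), hle z hz]
    field_simp
    ring

lemma hasLogOn_far {E : Set ℂ} {a : ℂ} (h : ∀ z ∈ E, ‖z‖ < ‖a‖) (ha : a ≠ 0) :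
    HasLogOn E a := by
  have hsl : ∀ z ∈ E, (1 + -(z / a)) ∈ Complex.slitPlane := by
    intro z hz
    apply Complex.mem_slitPlane_of_norm_lt_one
    rw [norm_neg, norm_div, div_lt_one (norm_pos_iff.2 ha)]
    exact h z hz
  refine ⟨fun z => Complex.log (-a) + Complex.log (1 + -(z / a)), ?_, ?_⟩
  · apply ContinuousOn.add continuousOn_const
    exact ContinuousOn.clog (by fun_prop) hsl
  · intro z hz
    rw [Complex.exp_add, Complex.exp_log (Complex.slitPlane_ne_zero (hsl z hz)),
      Complex.exp_log (neg_ne_zero.2 ha)]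
    field_simp
    ring

lemma hasLogOn_locally_const {E : Set ℂ} (hE : IsClosed E) {a : ℂ} (ha : a ∉ E) :
    ∃ d > 0, ∀ b ∈ ball a d, b ∉ E ∧ (HasLogOn E a ↔ HasLogOn E b) := by
  obtain ⟨d, hd, hball⟩ := Metric.isOpen_iff.1 hE.isOpen_compl a ha
  refine ⟨d / 2, by positivity, fun b hb => ?_⟩
  have hb' : ‖a - b‖ < d / 2 := by
    rw [mem_ball, dist_comm, dist_eq_norm] at hb; exact hb
  have h1 : ∀ z ∈ E, d ≤ ‖z - a‖ := by
    intro z hz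
    by_contra hlt
    exact hball (by rw [mem_ball, dist_eq_norm]; exact not_le.1 hlt) hz
  refine ⟨?_, ?_, ?_⟩
  · intro hbE
    have := h1 b hbE
    rw [norm_sub_rev] at this
    linarith
  · intro h
    exact h.step (fun z hz => by have := h1 z hz; linarith)
  · intro h
    refine h.step (fun z hz => ?_)
    have h2 := h1 z hz
    have h3 : ‖z - a‖ ≤ ‖z - b‖ + ‖a - b‖ := by
      have := norm_sub_le (z - b) (a - b)
      simpa using this
    rw [norm_sub_rev b a]
    linarith

lemma hasLogOn_of_unbounded {E : Set ℂ} (hE : IsCompact E) {a : ℂ} (ha : a ∉ E)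
    (hU : ¬ Bornology.IsBounded (connectedComponentIn Eᶜ a)) : HasLogOn E a := by
  set U := connectedComponentIn Eᶜ a with hUdef
  obtain ⟨M, hM⟩ := hE.isBounded.exists_norm_le
  have : ∃ b ∈ U, max M 0 < ‖b‖ := by
    by_contra hcon
    push Not at hcon
    exact hU (isBounded_iff_forall_norm_le.2 ⟨_, hcon⟩)
  obtain ⟨b, hbU, hb⟩ := this
  have hbL : HasLogOn E b := by
    apply hasLogOn_far
    · intro z hz
      exact lt_of_le_of_lt ((hM z hz).trans (le_max_left _ _)) hb
    · rw [← norm_pos_iff]; exact lt_of_le_of_lt (le_max_right _ _) hb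
  have hS : IsOpen {x | x ∉ E ∧ HasLogOn E x} := by
    rw [Metric.isOpen_iff]
    rintro x ⟨hx, hxl⟩
    obtain ⟨d, hd, h⟩ := hasLogOn_locally_const hE.isClosed hx
    exact ⟨d, hd, fun y hy => ⟨(h y hy).1, (h y hy).2.1 hxl⟩⟩
  have hT : IsOpen {x | x ∉ E ∧ ¬ HasLogOn E x} := by
    rw [Metric.isOpen_iff]
    rintro x ⟨hx, hxl⟩
    obtain ⟨d, hd, h⟩ := hasLogOn_locally_const hE.isClosed hx
    exact ⟨d, hd, fun y hy => ⟨(h y hy).1, fun h' => hxl ((h y hy).2.2 h')⟩⟩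
  have hUE : U ⊆ Eᶜ := connectedComponentIn_subset _ _
  have hsub := IsPreconnected.subset_left_of_subset_union hS hT
    (Set.disjoint_left.2 fun x hx hx' => hx'.2 hx.2)
    (s := U) (fun x hx => by
      by_cases h : HasLogOn E x
      · exact Or.inl ⟨hUE hx, h⟩
      · exact Or.inr ⟨hUE hx, h⟩)
    ⟨b, hbU, hUE hbU, hbL⟩ isPreconnected_connectedComponentIn
  exact (hsub (mem_connectedComponentIn ha)).2

lemma log_diff_const {S : Set ℂ} (hS : IsPreconnected S) {l₁ l₂ : ℂ → ℂ}
    (h₁ : ContinuousOn l₁ S) (h₂ : ContinuousOn l₂ S)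
    (h : ∀ z ∈ S, Complex.exp (l₁ z) = Complex.exp (l₂ z)) {x y : ℂ} (hx : x ∈ S) (hy : y ∈ S) :
    l₁ x - l₂ x = l₁ y - l₂ y := by
  have key : ∀ z ∈ S, ∃ n : ℤ, l₁ z - l₂ z = n * (2 * Real.pi * Complex.I) := by
    intro z hz
    obtain ⟨n, hn⟩ := Complex.exp_eq_exp_iff_exists_int.1 (h z hz)
    exact ⟨n, by rw [hn]; ring⟩
  have hpi : (0:ℝ) < 2 * Real.pi := by positivity
  have him : ∀ z ∈ S, ∀ n : ℤ, l₁ z - l₂ z = n * (2 * Real.pi * Complex.I) →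
      (l₁ z - l₂ z).im / (2 * Real.pi) = n := by
    intro z hz n hn
    rw [hn, div_eq_iff hpi.ne']
    simp
  have hcont : ContinuousOn (fun z => (l₁ z - l₂ z).im / (2 * Real.pi)) S :=
    (Complex.continuous_im.comp_continuousOn (h₁.sub h₂)).div_const _
  have main : ∀ x ∈ S, ∀ y ∈ S, ∀ n m : ℤ, l₁ x - l₂ x = n * (2 * Real.pi * Complex.I) →
      l₁ y - l₂ y = m * (2 * Real.pi * Complex.I) → ¬ n < m := by
    intro x hx y hy n m hn hm hnm
    have hiv := hS.intermediate_value hx hy hcont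
    have hnm' : (n:ℝ) + 1 ≤ m := by exact_mod_cast hnm
    have hmem : (n:ℝ) + 1 / 2 ∈ Icc ((l₁ x - l₂ x).im / (2 * Real.pi))
        ((l₁ y - l₂ y).im / (2 * Real.pi)) := by
      rw [him x hx n hn, him y hy m hm]
      constructor <;> linarith
    obtain ⟨z, hz, hzv⟩ := hiv hmem
    obtain ⟨k, hk⟩ := key z hz
    have h3 : (l₁ z - l₂ z).im / (2 * Real.pi) = n + 1 / 2 := hzv
    rw [him z hz k hk] at h3
    have h4 : (2 * k : ℝ) = 2 * n + 1 := by linarith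
    have h5 : 2 * k = 2 * n + 1 := by exact_mod_cast h4
    omega
  obtain ⟨n, hn⟩ := key x hx
  obtain ⟨m, hm⟩ := key y hy
  have : n = m := le_antisymm (not_lt.1 (main y hy x hx m n hm hn)) (not_lt.1 (main x hx y hy n m hn hm))
  rw [hn, hm, this]

lemma not_hasLogOn_sym {R : Set ℂ} (hR : IsPreconnected R) {r t : ℝ}
    (hre : ∀ z ∈ R, r ≤ z.re) (hr : (r:ℂ) ∉ R)
    (h1 : (r:ℂ) + t * Complex.I ∈ R) (h2 : (r:ℂ) - t * Complex.I ∈ R) :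
    ¬ HasLogOn (R ∪ (fun z => 2 * (r:ℂ) - z) '' R) r := by
  rintro ⟨l, hl, hle⟩
  have ht : t ≠ 0 := by
    rintro rfl
    simp at h1; exact hr h1
  have hslit : ∀ z ∈ R, z - r ∈ Complex.slitPlane := by
    intro z hz
    have hz1 := hre z hz
    rcases hz1.lt_or_eq with h | h
    · left; simpa using h
    · right
      intro him
      apply hr
      have : z = r := by
        apply Complex.ext
        · simp [h]
        · simpa using him
      rwa [← this]
  have A := log_diff_const hR (l₁ := l) (l₂ := fun z => Complex.log (z - r))
    (hl.mono subset_union_left)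
    (ContinuousOn.clog (by fun_prop) hslit)
    (fun z hz => by
      rw [hle z (Or.inl hz), Complex.exp_log (Complex.slitPlane_ne_zero (hslit z hz))]) h1 h2
  have hR' : IsPreconnected ((fun z => 2 * (r:ℂ) - z) '' R) := hR.image _ (by fun_prop)
  have hslit' : ∀ z ∈ (fun z => 2 * (r:ℂ) - z) '' R, r - z ∈ Complex.slitPlane := by
    rintro _ ⟨z, hz, rfl⟩
    have := hslit z hz
    convert this using 1
    ring
  have B := log_diff_const hR' (l₁ := l) (l₂ := fun z => Complex.log (r - z) + Real.pi * Complex.I)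
    (hl.mono subset_union_right)
    ((ContinuousOn.clog (by fun_prop) hslit').add continuousOn_const)
    (fun z hz => by
      rw [hle z (Or.inr hz), Complex.exp_add,
        Complex.exp_log (Complex.slitPlane_ne_zero (hslit' z hz)), Complex.exp_pi_mul_I]
      ring)
    (x := (r:ℂ) + t * Complex.I) (y := (r:ℂ) - t * Complex.I)
    ⟨_, h2, by ring⟩ ⟨_, h1, by ring⟩
  simp only [add_sub_cancel_left, sub_sub_cancel, sub_add_cancel_left, sub_sub_cancel_left] at A B
  have C : Complex.log (t * Complex.I) = Complex.log (-(t * Complex.I)) := by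
    linear_combination (B - A) / 2
  have ht' : (t * Complex.I : ℂ) ≠ 0 := by simp [ht]
  have D := congrArg Complex.exp C
  rw [Complex.exp_log ht', Complex.exp_log (neg_ne_zero.2 ht')] at D
  exact ht' (self_eq_neg.1 D)

lemma le_of_forall_pow {a x e : ℝ} (ha : 0 < a) (he : 0 < e)
    (h : ∀ n : ℕ, a * x ^ n ≤ e ^ n) : x ≤ e := by
  by_contra hlt
  have hlt := not_le.1 hlt
  obtain ⟨n, hn⟩ := pow_unbounded_of_one_lt (1 / a) ((one_lt_div he).2 hlt)
  have h1 := h n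
  rw [div_pow, div_lt_div_iff₀ ha (pow_pos he n)] at hn
  linarith

/-- Maximum principle in the filled hull of `E`. -/
lemma max_hull {E Ω : Set ℂ} (hE : IsCompact E) (hΩ : IsOpen Ω) (c : ℂ)
    (hstar : ∀ e ∈ E, ∀ t ∈ Ico (0:ℝ) 1, c + t * (e - c) ∈ Ω)
    {g p : ℂ → ℂ} {C ε : ℝ} (hg : DifferentiableOn ℂ g Ω) (hC : ∀ z ∈ Ω, ‖g z‖ ≤ C)
    (hε : 0 < ε) (hgE : ∀ z ∈ E, z ∈ Ω → ‖g z‖ ≤ ε)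
    (hp : Differentiable ℂ p) (hp1 : ∀ z ∈ Ω, ‖p z‖ ≤ 1) (hp0 : ∀ z ∈ E, z ∉ Ω → p z = 0)
    {z₀ : ℂ} (hz₀ : z₀ ∉ E) (hbd : Bornology.IsBounded (connectedComponentIn Eᶜ z₀))
    (hpz : p z₀ ≠ 0) : ‖g z₀‖ ≤ ε := by
  classical
  set U := connectedComponentIn Eᶜ z₀ with hU
  have hUE : U ⊆ Eᶜ := connectedComponentIn_subset _ _
  have hz₀U : z₀ ∈ U := mem_connectedComponentIn hz₀
  have hUopen : IsOpen U := hE.isClosed.isOpen_compl.connectedComponentIn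
  have hUpre : IsPreconnected U := isPreconnected_connectedComponentIn
  have hUΩ : U ⊆ Ω := by
    intro z hz
    by_contra hzΩ
    have hray : IsPreconnected ((fun s : ℝ => c + s * (z - c)) '' Ici 1) :=
      isPreconnected_Ici.image _ (by fun_prop)
    have hrayE : (fun s : ℝ => c + s * (z - c)) '' Ici 1 ⊆ Eᶜ := by
      rintro _ ⟨s, hs, rfl⟩ hmem
      have hs : (1:ℝ) ≤ s := hs
      rcases hs.eq_or_lt with h | h
      · subst h
        apply hUE hz
        simpa using hmem
      · apply hzΩ
        have := hstar _ hmem (1 / s) ⟨by positivity, by rw [div_lt_one (by linarith)]; exact h⟩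
        have hs0 : (s:ℂ) ≠ 0 := by
          have : s ≠ 0 := by linarith
          exact_mod_cast this
        convert this using 1
        push_cast
        field_simp
        ring
    have hzray : z ∈ (fun s : ℝ => c + s * (z - c)) '' Ici 1 := ⟨1, by simp, by simp⟩
    have hsub := hray.subset_connectedComponentIn hzray hrayE
    rw [← connectedComponentIn_eq hz] at hsub
    have hzc : z - c ≠ 0 := by
      intro h0
      have hzc : z = c := sub_eq_zero.1 h0
      -- `E` nonempty would put `c` in `Ω`
      by_cases hne : E.Nonempty
      · obtain ⟨e, he⟩ := hne
        have := hstar e he 0 ⟨le_refl _, one_pos⟩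
        simp at this
        exact hzΩ (hzc ▸ this)
      · rw [Set.not_nonempty_iff_eq_empty] at hne
        rw [hU, hne, compl_empty, connectedComponentIn_univ,
          PreconnectedSpace.connectedComponent_eq_univ] at hbd
        exact NormedSpace.unbounded_univ ℝ ℂ hbd
    obtain ⟨M, hM⟩ := (hbd.subset hsub).exists_norm_le
    have hM0 : 0 ≤ M := (norm_nonneg _).trans (hM _ hzray)
    have hpos : 0 < ‖z - c‖ := norm_pos_iff.2 hzc
    set s : ℝ := 1 + (M + ‖c‖ + 1) / ‖z - c‖ with hs
    have hs1 : 1 ≤ s := by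
      have : 0 ≤ (M + ‖c‖ + 1) / ‖z - c‖ := by positivity
      linarith
    have h1 := hM _ ⟨s, hs1, rfl⟩
    have h2 : ‖(s:ℂ) * (z - c)‖ ≤ ‖c + s * (z - c)‖ + ‖c‖ := by
      have := norm_sub_le (c + s * (z - c)) c
      simpa using this
    rw [norm_mul, Complex.norm_real, Real.norm_of_nonneg (by linarith)] at h2
    have h3 : s * ‖z - c‖ = ‖z - c‖ + (M + ‖c‖ + 1) := by
      rw [hs]; field_simp
    simp only at h1
    linarith
  have hcl : ∀ x ∈ closure U, x ∉ E → x ∈ U := by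
    intro x hx hxE
    have hins : IsPreconnected (insert x U) :=
      hUpre.subset_closure (subset_insert _ _) (insert_subset hx subset_closure)
    have := hins.subset_connectedComponentIn (F := Eᶜ) (mem_insert_of_mem x hz₀U)
      (insert_subset hxE hUE)
    exact this (mem_insert _ _)
  apply le_of_forall_pow (norm_pos_iff.2 hpz) hε
  intro n
  let G : ℂ → ℂ := fun z => if z ∈ Ω then p z * g z ^ n else 0
  have hGd : DifferentiableOn ℂ G Ω := by
    apply DifferentiableOn.congr (f := fun z => p z * g z ^ n)
    · exact hp.differentiableOn.mul (hg.pow n)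
    · intro z hz
      simp only [G, if_pos hz]
  have hGcont : ContinuousOn G (closure U) := by
    intro x hx
    by_cases hxΩ : x ∈ Ω
    · exact ((hGd x hxΩ).differentiableAt (hΩ.mem_nhds hxΩ)).continuousAt.continuousWithinAt
    · have hxE : x ∈ E := by
        by_contra h
        exact hxΩ (hUΩ (hcl x hx h))
      apply ContinuousAt.continuousWithinAt
      have hGx : G x = 0 := by simp only [G, if_neg hxΩ]
      rw [ContinuousAt, hGx]
      apply squeeze_zero_norm (a := fun z => ‖p z‖ * |C| ^ n)
      · intro z
        by_cases hz : z ∈ Ω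
        · simp only [G, if_pos hz, norm_mul, norm_pow]
          gcongr
          exact (hC z hz).trans (le_abs_self C)
        · simp only [G, if_neg hz, norm_zero]
          positivity
      · have : Tendsto (fun z => ‖p z‖ * |C| ^ n) (nhds x) (nhds (‖p x‖ * |C| ^ n)) :=
          ((hp.continuous.norm).mul continuous_const).tendsto x
        simpa [hp0 x hxE hxΩ] using this
  have hGcl : DiffContOnCl ℂ G U := ⟨hGd.mono hUΩ, hGcont⟩
  have hfr : ∀ z ∈ frontier U, ‖G z‖ ≤ ε ^ n := by
    intro z hz
    rw [hUopen.frontier_eq] at hz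
    have hzE : z ∈ E := by
      by_contra h
      exact hz.2 (hcl z hz.1 h)
    by_cases hzΩ : z ∈ Ω
    · simp only [G, if_pos hzΩ, norm_mul, norm_pow]
      calc ‖p z‖ * ‖g z‖ ^ n ≤ 1 * ε ^ n := by
            gcongr
            · exact hp1 z hzΩ
            · exact hgE z hzE hzΩ
        _ = ε ^ n := one_mul _
    · simp only [G, if_neg hzΩ, norm_zero]
      positivity
  have := Complex.norm_le_of_forall_mem_frontier_norm_le hbd hGcl hfr (subset_closure hz₀U)
  simpa only [G, if_pos (hUΩ hz₀U), norm_mul, norm_pow] using this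

open ComplexConjugate in
lemma radial_core {g : ℂ → ℂ} (hg : DifferentiableOn ℂ g (ball (0:ℂ) 1))
    (hb : ∀ z ∈ ball (0:ℂ) 1, ‖g z‖ ≤ 1) {γ : ℝ → ℂ} {t₁ r ε : ℝ} (ht : t₁ < 1)
    (hr0 : 0 < r) (hr1 : r < 1) (hε : 0 < ε)
    (hc : ContinuousOn γ (Icc t₁ 1)) (h1 : γ 1 = 1)
    (hD : ∀ t ∈ Ico t₁ 1, γ t ∈ ball (0:ℂ) 1) (hstart : (γ t₁).re = r)
    (hre : ∀ t ∈ Icc t₁ 1, r ≤ (γ t).re) (hsmall : ∀ t ∈ Ico t₁ 1, ‖g (γ t)‖ ≤ ε) :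
    ‖g r‖ ^ 4 ≤ ε := by
  set E₁ := γ '' Icc t₁ 1 with hE₁
  set R := E₁ ∪ conj '' E₁ with hR
  set E := R ∪ (fun z => 2 * (r:ℂ) - z) '' R with hEdef
  have hcconj : Continuous (conj : ℂ → ℂ) := Complex.continuous_conj
  have hE₁c : IsCompact E₁ := isCompact_Icc.image_of_continuousOn hc
  have hRc : IsCompact R := hE₁c.union (hE₁c.image hcconj)
  have hEc : IsCompact E := hRc.union (hRc.image (by fun_prop))
  have hE₁p : IsPreconnected E₁ := isPreconnected_Icc.image _ hc
  have h1E : (1:ℂ) ∈ E₁ := ⟨1, ⟨ht.le, le_refl _⟩, h1⟩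
  have hRp : IsPreconnected R :=
    IsPreconnected.union 1 h1E ⟨1, h1E, by simp⟩ hE₁p (hE₁p.image _ hcconj.continuousOn)
  have hγt₁ : γ t₁ ∈ E₁ := ⟨t₁, ⟨le_refl _, ht.le⟩, rfl⟩
  set k : ℂ → ℂ := fun z => g z * conj (g (conj z)) with hk
  have hconjball : ∀ z : ℂ, z ∈ ball (0:ℂ) 1 → conj z ∈ ball (0:ℂ) 1 := by
    intro z hz
    simpa using hz
  have hkd : DifferentiableOn ℂ k (ball (0:ℂ) 1) := by
    intro z hz
    have e1 : DifferentiableAt ℂ g z := (hg z hz).differentiableAt (isOpen_ball.mem_nhds hz)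
    have e2 : DifferentiableAt ℂ g (conj z) :=
      (hg _ (hconjball z hz)).differentiableAt (isOpen_ball.mem_nhds (hconjball z hz))
    have e3 : DifferentiableAt ℂ (conj ∘ g ∘ conj) z := by
      have := e2.conj_conj
      simpa using this
    exact (e1.mul e3).differentiableWithinAt
  have hkb : ∀ z ∈ ball (0:ℂ) 1, ‖k z‖ ≤ 1 := by
    intro z hz
    simp only [hk, norm_mul, RCLike.norm_conj]
    exact mul_le_one₀ (hb z hz) (norm_nonneg _) (hb _ (hconjball z hz))
  have hE₁prop : ∀ z ∈ E₁, r ≤ z.re ∧ (z = 1 ∨ (z ∈ ball (0:ℂ) 1 ∧ ‖g z‖ ≤ ε)) := by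
    rintro _ ⟨t, htt, rfl⟩
    refine ⟨hre t htt, ?_⟩
    rcases htt.2.eq_or_lt with h | h
    · left; rw [h, h1]
    · right; exact ⟨hD t ⟨htt.1, h⟩, hsmall t ⟨htt.1, h⟩⟩
  have hRprop : ∀ z ∈ R, r ≤ z.re ∧ (z = 1 ∨ (z ∈ ball (0:ℂ) 1 ∧ ‖k z‖ ≤ ε)) := by
    rintro z (hz | ⟨w, hw, rfl⟩)
    · obtain ⟨h2, h3⟩ := hE₁prop z hz
      refine ⟨h2, h3.imp id fun h => ⟨h.1, ?_⟩⟩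
      simp only [hk, norm_mul, RCLike.norm_conj]
      calc _ ≤ ε * 1 := mul_le_mul h.2 (hb _ (hconjball z h.1)) (norm_nonneg _) hε.le
        _ = ε := mul_one _
    · obtain ⟨h2, h3⟩ := hE₁prop w hw
      refine ⟨by simpa using h2, h3.imp (fun h => by simp [h]) fun h => ⟨hconjball w h.1, ?_⟩⟩
      simp only [hk, norm_mul, RCLike.norm_conj, Complex.conj_conj]
      calc _ ≤ 1 * ε := mul_le_mul (hb _ (hconjball w h.1)) h.2 (norm_nonneg _) zero_le_one
        _ = ε := one_mul _
  have hrefl : ∀ z : ℂ, r ≤ z.re → ‖2 * (r:ℂ) - z‖ ≤ ‖z‖ := by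
    intro z hz
    rw [← sq_le_sq₀ (norm_nonneg _) (norm_nonneg _), Complex.sq_norm, Complex.sq_norm,
      Complex.normSq_apply, Complex.normSq_apply]
    simp
    nlinarith
  have hRnorm : ∀ z ∈ R, ‖z‖ ≤ 1 := by
    intro z hz
    rcases (hRprop z hz).2 with h | h
    · simp [h]
    · have := h.1; rw [mem_ball_zero_iff] at this; exact this.le
  have hEnorm : ∀ e ∈ E, ‖e‖ ≤ 1 ∧ ‖2 * (r:ℂ) - e‖ ≤ 1 := by
    rintro e (he | ⟨w, hw, rfl⟩)
    · exact ⟨hRnorm e he, (hrefl e (hRprop e he).1).trans (hRnorm e he)⟩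
    · refine ⟨(hrefl w (hRprop w hw).1).trans (hRnorm w hw), ?_⟩
      simpa using hRnorm w hw
  set Ω := ball (0:ℂ) 1 ∩ (fun z => 2 * (r:ℂ) - z) ⁻¹' ball (0:ℂ) 1 with hΩ
  have hΩo : IsOpen Ω := isOpen_ball.inter (isOpen_ball.preimage (by fun_prop))
  have hRΩ : ∀ z ∈ R, z ∈ ball (0:ℂ) 1 → 2 * (r:ℂ) - z ∈ ball (0:ℂ) 1 := by
    intro z hz hzb
    rw [mem_ball_zero_iff] at *
    exact lt_of_le_of_lt (hrefl z (hRprop z hz).1) hzb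
  have hseg : ∀ e : ℂ, ‖e‖ ≤ 1 → ∀ t ∈ Ico (0:ℝ) 1, ‖(r:ℂ) + t * (e - r)‖ < 1 := by
    intro e he t ht
    have : (r:ℂ) + t * (e - r) = ((1 - t : ℝ) : ℂ) * r + t * e := by push_cast; ring
    rw [this]
    calc _ ≤ ‖((1 - t : ℝ) : ℂ) * r‖ + ‖(t:ℂ) * e‖ := norm_add_le _ _
      _ = (1 - t) * r + t * ‖e‖ := by
        rw [norm_mul, norm_mul, Complex.norm_real, Complex.norm_real, Complex.norm_real,
          Real.norm_of_nonneg (by linarith [ht.2]), Real.norm_of_nonneg hr0.le,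
          Real.norm_of_nonneg ht.1]
      _ < 1 := by nlinarith [ht.1, ht.2]
  set h : ℂ → ℂ := fun z => k z * k (2 * (r:ℂ) - z) with hh
  have hhr : ‖h r‖ = ‖g r‖ ^ 4 := by
    have : (2 * (r:ℂ) - r) = r := by ring
    simp only [hh, hk, this, norm_mul, RCLike.norm_conj, Complex.conj_ofReal]
    ring
  have hhE : ∀ z ∈ E, z ∈ Ω → ‖h z‖ ≤ ε := by
    rintro z (hz | ⟨w, hw, rfl⟩) hzΩ
    · have h3 : ‖k z‖ ≤ ε := by
        rcases (hRprop z hz).2 with h' | h'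
        · have := hzΩ.1; rw [h'] at this; simp at this
        · exact h'.2
      simp only [hh, norm_mul]
      calc _ ≤ ε * 1 := mul_le_mul h3 (hkb _ hzΩ.2) (norm_nonneg _) hε.le
        _ = ε := mul_one _
    · have hw2 : w ∈ ball (0:ℂ) 1 := by
        have := hzΩ.2
        simpa using this
      have h3 : ‖k w‖ ≤ ε := by
        rcases (hRprop w hw).2 with h' | h'
        · rw [h'] at hw2; simp at hw2
        · exact h'.2
      simp only [hh, norm_mul, sub_sub_cancel]
      calc _ ≤ 1 * ε := mul_le_mul (hkb _ hzΩ.1) h3 (norm_nonneg _) zero_le_one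
        _ = ε := one_mul _
  have hrball : (r:ℂ) ∈ ball (0:ℂ) 1 := by
    rw [mem_ball_zero_iff, Complex.norm_real, Real.norm_of_nonneg hr0.le]; exact hr1
  rw [← hhr]
  by_cases hrE : (r:ℂ) ∈ E
  · apply hhE r hrE
    refine ⟨hrball, ?_⟩
    have : (2 * (r:ℂ) - r) = r := by ring
    rw [mem_preimage, this]; exact hrball
  · have hrR : (r:ℂ) ∉ R := fun h => hrE (Or.inl h)
    have hbd : Bornology.IsBounded (connectedComponentIn Eᶜ (r:ℂ)) := by
      by_contra hunb
      refine not_hasLogOn_sym hRp (t := (γ t₁).im) (fun z hz => (hRprop z hz).1) hrR ?_ ?_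
        (hasLogOn_of_unbounded hEc hrE hunb)
      · left
        have : (r:ℂ) + (γ t₁).im * Complex.I = γ t₁ := by rw [← hstart]; exact Complex.re_add_im _
        rw [this]; exact hγt₁
      · right
        refine ⟨γ t₁, hγt₁, ?_⟩
        apply Complex.ext <;> simp [hstart]
    refine max_hull (p := fun z => (1 - z) * (1 - (2 * (r:ℂ) - z)) / 4) (C := 1) hEc hΩo r
      ?_ ?_ ?_ hε hhE ?_ ?_ ?_ hrE hbd ?_
    · intro e he t ht
      refine ⟨?_, ?_⟩
      · rw [mem_ball_zero_iff]; exact hseg e (hEnorm e he).1 t ht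
      · rw [mem_preimage, mem_ball_zero_iff]
        have := hseg _ (hEnorm e he).2 t ht
        have e2 : 2 * (r:ℂ) - (r + t * (e - r)) = r + t * ((2 * (r:ℂ) - e) - r) := by ring
        change ‖2 * (r:ℂ) - (r + t * (e - r))‖ < 1
        rw [e2]
        exact this
    · apply DifferentiableOn.mul (hkd.mono inter_subset_left)
      exact hkd.comp (by fun_prop) (fun z hz => hz.2)
    · intro z hz
      simp only [hh, norm_mul]
      exact mul_le_one₀ (hkb z hz.1) (norm_nonneg _) (hkb _ hz.2)
    · fun_prop
    · intro z hz
      have a1 : ‖z‖ < 1 := by simpa using hz.1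
      have a2 : ‖2 * (r:ℂ) - z‖ < 1 := by simpa using hz.2
      have b1 := norm_sub_le (1:ℂ) z
      have b2 := norm_sub_le (1:ℂ) (2 * (r:ℂ) - z)
      rw [norm_one] at b1 b2
      rw [norm_div, norm_mul]
      have : ‖(4:ℂ)‖ = 4 := by norm_num
      rw [this, div_le_one (by norm_num)]
      nlinarith [norm_nonneg (1 - z), norm_nonneg (1 - (2 * (r:ℂ) - z))]
    · rintro z (hz | ⟨w, hw, rfl⟩) hzΩ
      · rcases (hRprop z hz).2 with h' | h'
        · simp [h']
        · exact absurd ⟨h'.1, hRΩ z hz h'.1⟩ hzΩ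
      · rcases (hRprop w hw).2 with h' | h'
        · simp [h']
        · exact absurd ⟨hRΩ w hw h'.1, by simpa using h'.1⟩ hzΩ
    · have : (1 - (r:ℂ)) ≠ 0 := by
        rw [sub_ne_zero]
        intro h'
        have : (1:ℝ) = r := by exact_mod_cast h'
        linarith
      have h2 : (2 * (r:ℂ) - r) = r := by ring
      simp only [h2]
      exact div_ne_zero (mul_ne_zero this this) (by norm_num)

lemma radial_unit {g : ℂ → ℂ} (hg : DifferentiableOn ℂ g (ball (0:ℂ) 1))
    (hb : ∀ z ∈ ball (0:ℂ) 1, ‖g z‖ ≤ 1) {γ : ℝ → ℂ}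
    (hc : ContinuousOn γ (Icc 0 1)) (h1 : γ 1 = 1)
    (hD : ∀ s ∈ Ioo (0:ℝ) 1, γ s ∈ ball (0:ℂ) 1)
    (hlim : Tendsto (fun s => g (γ s)) (nhdsWithin 1 (Iio 1)) (nhds 0)) :
    Tendsto (fun x : ℝ => g x) (nhdsWithin 1 (Iio 1)) (nhds 0) := by
  rw [Metric.tendsto_nhds]
  intro η hη
  set ε := (η / 2) ^ 4 with hεdef
  have hε : 0 < ε := by positivity
  have hev := (Metric.tendsto_nhds.1 hlim) ε hε
  obtain ⟨a, ha1, ha⟩ := (mem_nhdsLT_iff_exists_Ioo_subset).1 hev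
  have ha1 : a < 1 := ha1
  obtain ⟨t₀, ht₀a, ht₀1⟩ := exists_between (max_lt ha1 one_pos)
  have ht₀0 : 0 < t₀ := (le_max_right _ _).trans_lt ht₀a
  have ht₀a' : a < t₀ := (le_max_left _ _).trans_lt ht₀a
  have hre0 : (γ t₀).re < 1 := by
    have := hD t₀ ⟨ht₀0, ht₀1⟩
    rw [mem_ball_zero_iff] at this
    exact lt_of_le_of_lt ((le_abs_self _).trans (Complex.abs_re_le_norm _)) this
  have hrange : Ioo (max (γ t₀).re 0) 1 ∈ nhdsWithin (1:ℝ) (Iio 1) :=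
    Ioo_mem_nhdsLT (max_lt hre0 one_pos)
  filter_upwards [hrange] with r hr
  have hr0 : 0 < r := (le_max_right _ _).trans_lt hr.1
  have hrre : (γ t₀).re < r := (le_max_left _ _).trans_lt hr.1
  have hcre : ContinuousOn (fun t => (γ t).re) (Icc t₀ 1) :=
    Complex.continuous_re.comp_continuousOn (hc.mono (Icc_subset_Icc_left ht₀0.le))
  have hScomp : IsCompact (Icc t₀ 1 ∩ (fun t => (γ t).re) ⁻¹' {r}) :=
    isCompact_Icc.of_isClosed_subset (hcre.preimage_isClosed_of_isClosed isClosed_Icc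
      isClosed_singleton) inter_subset_left
  have hSne : (Icc t₀ 1 ∩ (fun t => (γ t).re) ⁻¹' {r}).Nonempty := by
    have := intermediate_value_Icc ht₀1.le hcre
    obtain ⟨s, hs, hsr⟩ := this (show r ∈ Icc (γ t₀).re (γ 1).re from
      ⟨hrre.le, by rw [h1]; simpa using hr.2.le⟩)
    exact ⟨s, hs, hsr⟩
  obtain ⟨t₁, ⟨ht₁mem, ht₁r⟩, ht₁max⟩ := hScomp.exists_isGreatest hSne
  have ht₁r : (γ t₁).re = r := ht₁r
  have ht₁1 : t₁ < 1 := by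
    rcases ht₁mem.2.lt_or_eq with h | h
    · exact h
    · rw [h, h1] at ht₁r
      simp at ht₁r
      linarith [hr.2]
  have key := radial_core hg hb ht₁1 hr0 hr.2 hε
    (hc.mono (Icc_subset_Icc_left (ht₀0.le.trans ht₁mem.1))) h1
    (fun t ht => hD t ⟨ht₀0.trans_le (ht₁mem.1.trans ht.1), ht.2⟩) ht₁r
    (by
      intro t ht
      by_contra hlt
      have hlt := not_le.1 hlt
      have := intermediate_value_Icc ht.2 (hcre.mono (Icc_subset_Icc_left (ht₁mem.1.trans ht.1)))
      obtain ⟨s, hs, hsr⟩ := this (show r ∈ Icc (γ t).re (γ 1).re from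
        ⟨hlt.le, by rw [h1]; simpa using hr.2.le⟩)
      have hst := ht₁max ⟨⟨ht₁mem.1.trans (ht.1.trans hs.1), hs.2⟩, hsr⟩
      have : t = t₁ := le_antisymm (hs.1.trans hst) ht.1
      rw [this, ht₁r] at hlt
      exact lt_irrefl _ hlt)
    (by
      intro t ht
      have := ha ⟨ht₀a'.trans_le (ht₁mem.1.trans ht.1), ht.2⟩
      have h2 : dist (g (γ t)) 0 < ε := this
      rw [dist_zero_right] at h2
      exact h2.le)
  rw [dist_zero_right]
  have : ‖g r‖ ≤ η / 2 := by
    rwa [hεdef, pow_le_pow_iff_left₀ (norm_nonneg _) (by positivity) (by norm_num)] at key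
  linarith

lemma radial_limit {f : ℂ → ℂ} (hf : DifferentiableOn ℂ f (ball (0:ℂ) 1)) {C : ℝ}
    (hb : ∀ z ∈ ball (0:ℂ) 1, ‖f z‖ ≤ C) {γ : ℝ → ℂ} {L : ℂ}
    (hc : ContinuousOn γ (Icc 0 1)) (h1 : γ 1 = 1)
    (hD : ∀ s ∈ Ioo (0:ℝ) 1, γ s ∈ ball (0:ℂ) 1)
    (hlim : Tendsto (fun s => f (γ s)) (nhdsWithin 1 (Iio 1)) (nhds L)) :
    Tendsto (fun x : ℝ => f x) (nhdsWithin 1 (Iio 1)) (nhds L) := by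
  set M : ℝ := |C| + ‖L‖ + 1 with hM
  have hM0 : 0 < M := by positivity
  have hMc : (M:ℂ) ≠ 0 := by exact_mod_cast hM0.ne'
  have := radial_unit (g := fun z => (f z - L) / M) ((hf.sub_const L).div_const _) ?_ hc h1 hD ?_
  · have h2 := (this.mul_const (M:ℂ)).add_const L
    simpa [div_mul_cancel₀ _ hMc] using h2
  · intro z hz
    rw [norm_div, Complex.norm_real, Real.norm_of_nonneg hM0.le, div_le_one hM0]
    have := norm_sub_le (f z) L
    have h3 := (hb z hz).trans (le_abs_self C)
    linarith
  · have h2 := (hlim.sub_const L).div_const (M:ℂ)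
    simpa using h2

lemma near_end {g : ℂ → ℂ} {γ : ℝ → ℂ} (hc : ContinuousOn γ (Icc 0 1)) (h0 : γ 0 = -1)
    (hD : ∀ s ∈ Ioo (0:ℝ) 1, γ s ∈ ball (0:ℂ) 1)
    (h1 : γ 1 = 1)
    (hlim : Tendsto (fun s => g (γ s)) (nhdsWithin 1 (Iio 1)) (nhds 0)) {ε : ℝ} (hε : 0 < ε) :
    ∃ δ > 0, ∀ z ∈ γ '' Icc 0 1, z ∈ ball (0:ℂ) 1 → ‖z - 1‖ < δ → ‖g z‖ ≤ ε := by
  have hev := (Metric.tendsto_nhds.1 hlim) ε hε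
  obtain ⟨a, ha1, ha⟩ := (mem_nhdsLT_iff_exists_Ioo_subset).1 hev
  have ha1 : a < 1 := ha1
  have hK : IsCompact (γ '' Icc 0 a) :=
    isCompact_Icc.image_of_continuousOn (hc.mono (Icc_subset_Icc_right ha1.le))
  have h1K : (1:ℂ) ∉ γ '' Icc 0 a := by
    rintro ⟨s, hs, hs1⟩
    rcases hs.1.eq_or_lt with h | h
    · rw [← h, h0] at hs1
      norm_num at hs1
    · have := hD s ⟨h, hs.2.trans_lt ha1⟩
      rw [hs1] at this
      simp at this
  obtain ⟨δ, hδ, hball⟩ := Metric.isOpen_iff.1 hK.isClosed.isOpen_compl 1 h1K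
  refine ⟨δ, hδ, ?_⟩
  rintro _ ⟨s, hs, rfl⟩ hsb hsδ
  have hsa : a < s := by
    by_contra hle
    exact hball (show γ s ∈ ball 1 δ by rw [mem_ball, dist_eq_norm]; exact hsδ)
      ⟨s, ⟨hs.1, not_lt.1 hle⟩, rfl⟩
  have hs1 : s < 1 := by
    rcases hs.2.lt_or_eq with h | h
    · exact h
    · rw [h, h1] at hsb; simp at hsb
  have h2 : dist (g (γ s)) 0 < ε := ha ⟨hsa, hs1⟩
  rw [dist_zero_right] at h2
  exact h2.le

lemma path_norm {γ : ℝ → ℂ} (h0 : γ 0 = -1) (h1 : γ 1 = 1)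
    (hD : ∀ s ∈ Ioo (0:ℝ) 1, γ s ∈ ball (0:ℂ) 1) :
    ∀ z ∈ γ '' Icc 0 1, z = -1 ∨ z = 1 ∨ z ∈ ball (0:ℂ) 1 := by
  rintro _ ⟨s, hs, rfl⟩
  rcases hs.1.eq_or_lt with h | h
  · left; rw [← h, h0]
  · rcases hs.2.eq_or_lt with h' | h'
    · right; left; rw [h', h1]
    · right; right; exact hD s ⟨h, h'⟩

lemma peak_bound {z : ℂ} {δ : ℝ} (hz : ‖z‖ < 1) (hδ : 0 ≤ δ) (h : δ ≤ ‖z - 1‖) :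
    ‖(1 + z) / 2‖ ^ 2 ≤ 1 - δ ^ 2 / 4 := by
  have h1 := parallelogram_law_with_norm ℝ z 1
  rw [norm_div, div_pow, add_comm]
  have : ‖(2:ℂ)‖ = 2 := by norm_num
  rw [this]
  rw [norm_one] at h1
  have h2 : δ * δ ≤ ‖z - 1‖ * ‖z - 1‖ := mul_self_le_mul_self hδ h
  have h3 : ‖z‖ * ‖z‖ ≤ 1 := by nlinarith [norm_nonneg z]
  nlinarith

theorem convergence_set_between_paths
    (f : ℂ → ℂ)
    (hf : DifferentiableOn ℂ f (ball (0:ℂ) 1))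
    (hb : ∃ C : ℝ, ∀ z ∈ ball (0:ℂ) 1, ‖f z‖ ≤ C)
    (γ₁ γ₂ : ℝ → ℂ)
    (hγ₁c : ContinuousOn γ₁ (Icc 0 1)) (hγ₁0 : γ₁ 0 = -1) (hγ₁1 : γ₁ 1 = 1)
    (hγ₁D : ∀ s ∈ Ioo (0:ℝ) 1, γ₁ s ∈ ball (0:ℂ) 1)
    (hγ₂c : ContinuousOn γ₂ (Icc 0 1)) (hγ₂0 : γ₂ 0 = -1) (hγ₂1 : γ₂ 1 = 1)
    (hγ₂D : ∀ s ∈ Ioo (0:ℝ) 1, γ₂ s ∈ ball (0:ℂ) 1)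
    (hlim₁ : ∃ L₁ : ℂ, Tendsto (fun s => f (γ₁ s)) (nhdsWithin 1 (Iio 1)) (nhds L₁))
    (hlim₂ : ∃ L₂ : ℂ, Tendsto (fun s => f (γ₂ s)) (nhdsWithin 1 (Iio 1)) (nhds L₂)) :
    ∃ ζ : ℂ, Tendsto f (nhdsWithin 1 (regionBetweenPaths γ₁ γ₂)) (nhds ζ) := by
  obtain ⟨C, hC⟩ := hb
  obtain ⟨L, hL₁⟩ := hlim₁
  obtain ⟨L₂, hL₂⟩ := hlim₂
  have hLL : L₂ = L := tendsto_nhds_unique (radial_limit hf hC hγ₂c hγ₂1 hγ₂D hL₂)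
    (radial_limit hf hC hγ₁c hγ₁1 hγ₁D hL₁)
  rw [hLL] at hL₂
  refine ⟨L, ?_⟩
  set g : ℂ → ℂ := fun z => f z - L with hg
  have hgd : DifferentiableOn ℂ g (ball (0:ℂ) 1) := hf.sub_const L
  set M : ℝ := |C| + ‖L‖ + 1 with hM
  have hM0 : 0 < M := by positivity
  have hgM : ∀ z ∈ ball (0:ℂ) 1, ‖g z‖ ≤ M := by
    intro z hz
    have h2 : ‖g z‖ ≤ ‖f z‖ + ‖L‖ := norm_sub_le (f z) L
    have h3 := (hC z hz).trans (le_abs_self C)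
    linarith
  have hg₁ : Tendsto (fun s => g (γ₁ s)) (nhdsWithin 1 (Iio 1)) (nhds 0) := by
    simpa using hL₁.sub_const L
  have hg₂ : Tendsto (fun s => g (γ₂ s)) (nhdsWithin 1 (Iio 1)) (nhds 0) := by
    simpa using hL₂.sub_const L
  rw [Metric.tendsto_nhds]
  intro η hη
  set ε := η / 4 with hεdef
  have hε : 0 < ε := by positivity
  obtain ⟨δ₁, hδ₁, hn₁⟩ := near_end hγ₁c hγ₁0 hγ₁D hγ₁1 hg₁ hε
  obtain ⟨δ₂, hδ₂, hn₂⟩ := near_end hγ₂c hγ₂0 hγ₂D hγ₂1 hg₂ hε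
  set δ := min (min δ₁ δ₂) 1 with hδdef
  have hδ : 0 < δ := lt_min (lt_min hδ₁ hδ₂) one_pos
  have hδ1 : δ ≤ 1 := min_le_right _ _
  have hδδ₁ : δ ≤ δ₁ := (min_le_left _ _).trans (min_le_left _ _)
  have hδδ₂ : δ ≤ δ₂ := (min_le_left _ _).trans (min_le_right _ _)
  have hq0 : 0 ≤ 1 - δ ^ 2 / 4 := by nlinarith
  have hq1 : 1 - δ ^ 2 / 4 < 1 := by nlinarith
  obtain ⟨N, hN⟩ := exists_pow_lt_of_lt_one (div_pos hε hM0) hq1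
  have hN' : M * (1 - δ ^ 2 / 4) ^ N ≤ ε := by
    rw [lt_div_iff₀ hM0] at hN; linarith
  set E := γ₁ '' Icc 0 1 ∪ γ₂ '' Icc 0 1 with hE
  have hEc : IsCompact E := (isCompact_Icc.image_of_continuousOn hγ₁c).union
    (isCompact_Icc.image_of_continuousOn hγ₂c)
  have hEn : ∀ z ∈ E, z = -1 ∨ z = 1 ∨ z ∈ ball (0:ℂ) 1 := by
    rintro z (hz | hz)
    · exact path_norm hγ₁0 hγ₁1 hγ₁D z hz
    · exact path_norm hγ₂0 hγ₂1 hγ₂D z hz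
  have hEnear : ∀ z ∈ E, z ∈ ball (0:ℂ) 1 → ‖z - 1‖ < δ → ‖g z‖ ≤ ε := by
    rintro z (hz | hz) hzb hzd
    · exact hn₁ z hz hzb (hzd.trans_le hδδ₁)
    · exact hn₂ z hz hzb (hzd.trans_le hδδ₂)
  set G : ℂ → ℂ := fun z => g z * (((1 + z) / 2) ^ 2) ^ N with hG
  have hpeak1 : ∀ z : ℂ, ‖z‖ < 1 → ‖(1 + z) / 2‖ ^ 2 ≤ 1 := by
    intro z hz
    simpa using peak_bound hz (le_refl 0) (norm_nonneg _)
  have hGle : ∀ z ∈ ball (0:ℂ) 1, ‖G z‖ ≤ ‖g z‖ := by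
    intro z hz
    rw [mem_ball_zero_iff] at hz
    simp only [hG, norm_mul, norm_pow]
    exact mul_le_of_le_one_right (norm_nonneg _) (pow_le_one₀ (by positivity) (hpeak1 z hz))
  have hGE : ∀ z ∈ E, z ∈ ball (0:ℂ) 1 → ‖G z‖ ≤ ε := by
    intro z hz hzb
    rcases lt_or_ge ‖z - 1‖ δ with h | h
    · exact (hGle z hzb).trans (hEnear z hz hzb h)
    · refine le_trans ?_ hN'
      have hzb' := hzb
      rw [mem_ball_zero_iff] at hzb'
      simp only [hG, norm_mul, norm_pow (((1 + z) / 2) ^ 2)]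
      rw [norm_pow]
      gcongr
      · exact hgM z hzb
      · exact peak_bound hzb' hδ.le h
  have hregion : ∀ z ∈ regionBetweenPaths γ₁ γ₂, ‖G z‖ ≤ ε := by
    rintro z ⟨hzb, hz | hz | ⟨hzE, hzbd⟩⟩
    · exact hGE z (Or.inl hz) hzb
    · exact hGE z (Or.inr hz) hzb
    · refine max_hull (p := fun z => (1 - z) * (1 + z) / 4) (C := M) hEc isOpen_ball 0
        ?_ ?_ (fun z hz => (hGle z hz).trans (hgM z hz)) hε hGE ?_ ?_ ?_ hzE hzbd ?_
      · intro e he t ht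
        have hen : ‖e‖ ≤ 1 := by
          rcases hEn e he with h | h | h
          · simp [h]
          · simp [h]
          · rw [mem_ball_zero_iff] at h; exact h.le
        rw [mem_ball_zero_iff, zero_add, sub_zero, norm_mul, Complex.norm_real,
          Real.norm_of_nonneg ht.1]
        nlinarith [ht.1, ht.2, norm_nonneg e]
      · apply hgd.mul
        fun_prop
      · fun_prop
      · intro z hz
        have a1 : ‖z‖ < 1 := by simpa using hz
        have b1 := norm_sub_le (1:ℂ) z
        have b2 := norm_add_le (1:ℂ) z
        rw [norm_one] at b1 b2
        rw [norm_div, norm_mul]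
        have : ‖(4:ℂ)‖ = 4 := by norm_num
        rw [this, div_le_one (by norm_num)]
        nlinarith [norm_nonneg (1 - z), norm_nonneg (1 + z)]
      · intro z hz hzn
        rcases hEn z hz with h | h | h
        · simp [h]
        · simp [h]
        · exact absurd h hzn
      · have hz1 : ‖z‖ < 1 := by simpa using hzb
        refine div_ne_zero (mul_ne_zero ?_ ?_) (by norm_num)
        · intro h
          rw [← sub_eq_zero.1 h] at hz1; simp at hz1
        · intro h
          have : z = -1 := by linear_combination h
          rw [this] at hz1; simp at hz1
  have hcont : Tendsto (fun z : ℂ => ‖(((1 + z) / 2) ^ 2) ^ N‖)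
      (nhdsWithin 1 (regionBetweenPaths γ₁ γ₂)) (nhds 1) := by
    have : Continuous (fun z : ℂ => ‖(((1 + z) / 2) ^ 2) ^ N‖) := by fun_prop
    have h2 := (this.tendsto 1).mono_left
      (nhdsWithin_le_nhds (s := regionBetweenPaths γ₁ γ₂))
    have h3 : ‖(((1 + (1:ℂ)) / 2) ^ 2) ^ N‖ = 1 := by norm_num
    rwa [h3] at h2
  have hhalf := hcont.eventually (lt_mem_nhds (show (1/2:ℝ) < 1 by norm_num))
  filter_upwards [hhalf, self_mem_nhdsWithin] with z hz hzR
  have h1 := hregion z hzR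
  simp only [hG] at h1
  rw [norm_mul] at h1
  rw [dist_eq_norm]
  change ‖g z‖ < η
  nlinarith [norm_nonneg (g z)]
end

section
/- Let $f:\mathbb{D}\to\mathbb{C}$ be a bounded analytic function on the open unit disk, and let $\gamma_3$ be a path in the disk from $-1$ to $1$ such that $\lim_{s\to 1^-} f(\gamma_3(s))$ does not exist. Then either the region above $\gamma_3$ or the region below $\gamma_3$ is a path divergence set for $f$ at $1$: that is, for one of these two regions $K$, for every path $\gamma$ whose trace intersected with $\mathbb{D}$ is contained in $K$, the limit $\lim_{s\to 1^-} f(\gamma(s))$ does not exist. -/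
open Set Metric Filter

/-- `K` is a path divergence set for `f` at `1`: `f` diverges along every path in the disk
from `-1` to `1` whose trace, intersected with the unit disk, is contained in `K`. -/
def IsPathDivergenceSet (f : ℂ → ℂ) (K : Set ℂ) : Prop :=
  ∀ γ : ℝ → ℂ, ContinuousOn γ (Icc 0 1) → γ 0 = -1 → γ 1 = 1 →
    (∀ s ∈ Ioo (0:ℝ) 1, γ s ∈ ball (0:ℂ) 1) →
    (γ '' Icc 0 1) ∩ ball (0:ℂ) 1 ⊆ K →
    ¬ ∃ L : ℂ, Tendsto (fun s => f (γ s)) (nhdsWithin 1 (Iio 1)) (nhds L)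


lemma edge_const (d : ℝ → ℂ) (hd : ContinuousOn d (Icc 0 1))
    (h : ∀ t ∈ Icc (0:ℝ) 1, Complex.exp (d t) = Complex.exp (d 0)) : d 1 = d 0 := by
  have hI : ContinuousOn (fun t => (d t - d 0).im / (2 * Real.pi)) (Icc 0 1) := by
    have : ContinuousOn (fun t => (d t - d 0).im) (Icc 0 1) :=
      Complex.continuous_im.comp_continuousOn (hd.sub continuousOn_const)
    exact this.div_const _
  have key : ∀ t ∈ Icc (0:ℝ) 1, ∃ n : ℤ, d t = d 0 + n * (2 * Real.pi * Complex.I) := by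
    intro t ht
    exact Complex.exp_eq_exp_iff_exists_int.1 (h t ht)
  have key2 : ∀ t ∈ Icc (0:ℝ) 1, ∃ n : ℤ, (d t - d 0).im / (2 * Real.pi) = n := by
    intro t ht
    obtain ⟨n, hn⟩ := key t ht
    refine ⟨n, ?_⟩
    rw [hn]
    have := Real.pi_pos
    simp
  obtain ⟨n, hn⟩ := key 1 (by simp)
  have h1 : (d 1 - d 0).im / (2 * Real.pi) = n := by
    rw [hn]
    have := Real.pi_pos
    simp
  have h0 : (d 0 - d 0).im / (2 * Real.pi) = 0 := by simp
  rcases lt_trichotomy n 0 with hlt | rfl | hgt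
  · exfalso
    have hle : (n:ℝ) ≤ -1 := by exact_mod_cast Int.le_sub_one_of_lt hlt
    have := intermediate_value_Icc' (zero_le_one) hI
    simp only [h1, h0] at this
    obtain ⟨t, ht, h2⟩ := this (show (-1/2:ℝ) ∈ Icc (n:ℝ) 0 by constructor <;> linarith)
    obtain ⟨m, hm⟩ := key2 t ht
    simp only at h2
    rw [hm] at h2
    have : (2 * m : ℤ) = -1 := by
      have : (2 * m : ℝ) = -1 := by linarith
      exact_mod_cast this
    omega
  · simpa using hn
  · exfalso
    have hle : (1:ℝ) ≤ n := by exact_mod_cast hgt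
    have := intermediate_value_Icc (zero_le_one) hI
    simp only [h1, h0] at this
    obtain ⟨t, ht, h2⟩ := this (show (1/2:ℝ) ∈ Icc 0 (n:ℝ) by constructor <;> linarith)
    obtain ⟨m, hm⟩ := key2 t ht
    simp only at h2
    rw [hm] at h2
    have : (2 * m : ℤ) = 1 := by
      have : (2 * m : ℝ) = 1 := by linarith
      exact_mod_cast this
    omega

lemma edge_log (l g : ℝ → ℂ) (hl : Continuous l) (hg : Continuous g)
    (hs : ∀ t ∈ Icc (0:ℝ) 1, g t ∈ Complex.slitPlane) (c : ℂ)
    (h : ∀ t, Complex.exp (l t) = c * g t) :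
    l 1 - l 0 = Complex.log (g 1) - Complex.log (g 0) := by
  have := edge_const (fun t => l t - Complex.log (g t))
    (hl.continuousOn.sub (hg.continuousOn.clog hs)) (by
      have aux : ∀ t ∈ Icc (0:ℝ) 1, Complex.exp (l t - Complex.log (g t)) = c := by
        intro t ht
        rw [Complex.exp_sub, h, Complex.exp_log (Complex.slitPlane_ne_zero (hs t ht))]
        field_simp [Complex.slitPlane_ne_zero (hs t ht)]
      intro t ht
      rw [aux t ht, aux 0 (by simp)])
  linear_combination this

/-- Two crossing paths meet. -/
lemma crossing (u v : ℝ → ℂ) (hu : Continuous u) (hv : Continuous v)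
    (hu2 : ∀ s, |(u s).im| < 2) (hv1 : ∀ t, |(v t).re| < 1)
    (u0 : u 0 = -1) (u1 : u 1 = 1) (v0 : v 0 = -(2 * Complex.I)) (v1 : v 1 = 2 * Complex.I) :
    ∃ s t, u s = v t := by
  by_contra! hne
  let F : C(ℝ × ℝ, ℂ) := ⟨fun p => u p.1 - v p.2, by fun_prop⟩
  have hF : ∀ p, F p ≠ 0 := fun p => sub_ne_zero.2 (hne p.1 p.2)
  obtain ⟨l, ⟨-, hl⟩, -⟩ := Complex.isCoveringMapOn_exp.existsUnique_continuousMap_lifts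
    (f := F) (a₀ := (0,0)) (e₀ := Complex.log (F (0,0))) (by rw [Complex.exp_log (hF _)])
      (by simpa using hF)
  have hl' : ∀ s t, Complex.exp (l (s,t)) = u s - v t := fun s t => congrFun hl (s,t)
  have b := edge_log (fun s => l (s,0)) (fun s => u s - v 0) (by fun_prop) (by fun_prop)
    (by intro t _
        right
        have := abs_lt.1 (hu2 t)
        simp [v0]
        linarith) 1 (by intro t; rw [hl', one_mul])
  have r := edge_log (fun t => l (1,t)) (fun t => u 1 - v t) (by fun_prop) (by fun_prop)
    (by intro t _
        left
        have := abs_lt.1 (hv1 t)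
        simp [u1]
        linarith) 1 (by intro t; rw [hl', one_mul])
  have tp := edge_log (fun s => l (s,1)) (fun s => u s - v 1) (by fun_prop) (by fun_prop)
    (by intro t _
        right
        have := abs_lt.1 (hu2 t)
        simp [v1]
        intro h; linarith) 1 (by intro t; rw [hl', one_mul])
  have lf := edge_log (fun t => l (0,t)) (fun t => v t - u 0) (by fun_prop) (by fun_prop)
    (by intro t _
        left
        have := abs_lt.1 (hv1 t)
        simp [u0]
        linarith) (-1) (by intro t; rw [hl']; ring)
  simp only [u0, u1, v0, v1] at b r tp lf
  have e : Complex.log (2 * Complex.I - -1) - Complex.log (-(2 * Complex.I) - -1)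
     = Complex.log (-1 - 2 * Complex.I) - Complex.log (-1 - -(2 * Complex.I)) := by
    linear_combination b + r - tp - lf
  have e2 := congrArg Complex.im e
  simp only [Complex.sub_im, Complex.log_im] at e2
  have a1 : 0 ≤ Complex.arg (2 * Complex.I - -1) := by
    rw [Complex.arg_nonneg_iff]; simp
  have a2 : Complex.arg (-(2 * Complex.I) - -1) < 0 := by
    rw [Complex.arg_neg_iff]; simp
  have a3 : Complex.arg (-1 - 2 * Complex.I) < 0 := by
    rw [Complex.arg_neg_iff]; simp
  have a4 : 0 ≤ Complex.arg (-1 - -(2 * Complex.I)) := by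
    rw [Complex.arg_nonneg_iff]; simp
  linarith

/-- A path in the disk from `-1` to `1`. -/
structure DPath (γ : ℝ → ℂ) : Prop where
  cont : ContinuousOn γ (Icc 0 1)
  zero : γ 0 = -1
  one : γ 1 = 1
  mem : ∀ s ∈ Ioo (0:ℝ) 1, γ s ∈ ball (0:ℂ) 1

lemma DPath.cases {γ : ℝ → ℂ} (h : DPath γ) {s : ℝ} (hs : s ∈ Icc (0:ℝ) 1) :
    γ s = -1 ∨ γ s = 1 ∨ (s ∈ Ioo (0:ℝ) 1 ∧ ‖γ s‖ < 1) := by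
  rcases eq_or_lt_of_le hs.1 with rfl | h0
  · exact Or.inl h.zero
  rcases eq_or_lt_of_le hs.2 with rfl | h1
  · exact Or.inr (Or.inl h.one)
  · exact Or.inr (Or.inr ⟨⟨h0, h1⟩, by simpa using h.mem s ⟨h0, h1⟩⟩)

lemma DPath.norm_le {γ : ℝ → ℂ} (h : DPath γ) {s : ℝ} (hs : s ∈ Icc (0:ℝ) 1) : ‖γ s‖ ≤ 1 := by
  rcases h.cases hs with h | h | ⟨-, h⟩
  · simp [h]
  · simp [h]
  · exact h.le

lemma DPath.notMem {γ : ℝ → ℂ} (h : DPath γ) {z : ℂ} (hz : 1 ≤ ‖z‖) (hre : |z.re| < 1) :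
    z ∉ γ '' Icc 0 1 := by
  rintro ⟨s, hs, rfl⟩
  rcases h.cases hs with h | h | ⟨-, h⟩
  · simp [h] at hre
  · simp [h] at hre
  · linarith

lemma DPath.isClosed {γ : ℝ → ℂ} (h : DPath γ) : IsClosed (γ '' Icc 0 1) :=
  (isCompact_Icc.image_of_continuousOn h.cont).isClosed

lemma abs_re_lt_of_norm_one {z : ℂ} (hz : ‖z‖ = 1) (him : z.im ≠ 0) : |z.re| < 1 := by
  have h := Complex.sq_norm z
  rw [hz, Complex.normSq_apply] at h
  rw [abs_lt]
  have : 0 < z.im * z.im := mul_self_pos.2 him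
  constructor <;> nlinarith

/-- a half-escape: from `ζ` on the circle to `±2i` outside the disk -/
lemma escape {γ : ℝ → ℂ} (h : DPath γ) {ζ : ℂ} (hz : ‖ζ‖ = 1) {e : ℝ} (he : e = 1 ∨ e = -1)
    (him : 0 < e * ζ.im) :
    ∃ S : Set ℂ, IsPreconnected S ∧ ζ ∈ S ∧ (2 * e * Complex.I) ∈ S ∧
      S ⊆ {z : ℂ | |z.re| < 1} \ γ '' Icc 0 1 := by
  have hee : e * e = 1 := by rcases he with rfl | rfl <;> norm_num
  have him0 : ζ.im ≠ 0 := by rintro h0; simp [h0] at him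
  have hre := abs_re_lt_of_norm_one hz him0
  have hsq := Complex.sq_norm ζ
  rw [hz, Complex.normSq_apply] at hsq
  have hnorm : ∀ z : ℂ, 1 ≤ z.re * z.re + z.im * z.im → 1 ≤ ‖z‖ := by
    intro z h1
    have := Complex.sq_norm z
    rw [Complex.normSq_apply] at this
    nlinarith [norm_nonneg z]
  refine ⟨segment ℝ ζ (ζ + 2 * e * Complex.I) ∪ segment ℝ (ζ + 2 * e * Complex.I) (2 * e * Complex.I),
    ?_, ?_, ?_, ?_⟩
  · exact IsPreconnected.union (ζ + 2 * e * Complex.I) (right_mem_segment _ _ _)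
      (left_mem_segment _ _ _) (convex_segment _ _).isPreconnected (convex_segment _ _).isPreconnected
  · exact Or.inl (left_mem_segment _ _ _)
  · exact Or.inr (right_mem_segment _ _ _)
  · have habs := abs_lt.1 hre
    rintro z (⟨a, b, ha, hb, hab, rfl⟩ | ⟨a, b, ha, hb, hab, rfl⟩)
    · have hR : (a • ζ + b • (ζ + 2 * e * Complex.I)).re = ζ.re := by
        simp; rw [← add_mul, hab, one_mul]
      have hI : (a • ζ + b • (ζ + 2 * e * Complex.I)).im = ζ.im + 2 * b * e := by
        simp; linear_combination ζ.im * hab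
      have hR1 : |(a • ζ + b • (ζ + 2 * e * Complex.I)).re| < 1 := by rw [hR]; exact hre
      refine ⟨hR1, h.notMem (hnorm _ ?_) hR1⟩
      rw [hR, hI]
      nlinarith [mul_nonneg hb him.le, mul_nonneg hb hb, hee]
    · have hR : (a • (ζ + 2 * e * Complex.I) + b • (2 * e * Complex.I)).re = a * ζ.re := by
        simp
      have hI : (a • (ζ + 2 * e * Complex.I) + b • (2 * e * Complex.I)).im = a * ζ.im + 2 * e := by
        simp; linear_combination 2 * e * hab
      have hR1 : |(a • (ζ + 2 * e * Complex.I) + b • (2 * e * Complex.I)).re| < 1 := by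
        rw [hR, abs_mul, abs_of_nonneg ha]
        have : a ≤ 1 := by linarith
        nlinarith [abs_nonneg ζ.re]
      refine ⟨hR1, h.notMem (hnorm _ ?_) hR1⟩
      rw [hR, hI]
      nlinarith [mul_nonneg ha him.le, mul_self_nonneg (a * ζ.re), mul_self_nonneg (a * ζ.im), hee]

lemma sep {γ : ℝ → ℂ} (h : DPath γ) {S : Set ℂ} (hS : IsPreconnected S)
    (hSD : S ⊆ ball (0:ℂ) 1 \ γ '' Icc 0 1) {ζ₁ ζ₂ : ℂ} (h1 : ζ₁ ∈ closure S) (h2 : ζ₂ ∈ closure S)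
    (n1 : ‖ζ₁‖ = 1) (n2 : ‖ζ₂‖ = 1) (i1 : 0 < ζ₁.im) (i2 : ζ₂.im < 0) : False := by
  let V : Set ℂ := {z : ℂ | |z.re| < 1} \ γ '' Icc 0 1
  have hVo : IsOpen V := (isOpen_lt (by fun_prop) continuous_const).sdiff h.isClosed
  have hSV : S ⊆ V := by
    intro z hz
    refine ⟨?_, (hSD hz).2⟩
    have := (hSD hz).1
    rw [mem_ball_zero_iff] at this
    exact (Complex.abs_re_le_norm z).trans_lt this
  obtain ⟨A, hA, hA1, hA2, hAV⟩ := escape h n1 (e := 1) (Or.inl rfl) (by linarith)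
  obtain ⟨B, hB, hB1, hB2, hBV⟩ := escape h n2 (e := -1) (Or.inr rfl) (by linarith)
  have hS' : IsPreconnected (insert ζ₁ (insert ζ₂ S)) := by
    refine hS.subset_closure (fun z hz => Or.inr (Or.inr hz)) ?_
    rintro z (rfl | rfl | hz)
    exacts [h1, h2, subset_closure hz]
  have hT : IsPreconnected ((insert ζ₁ (insert ζ₂ S) ∪ A) ∪ B) := by
    refine IsPreconnected.union ζ₂ (Or.inl (Or.inr (Or.inl rfl))) hB1 ?_ hB
    exact IsPreconnected.union ζ₁ (Or.inl rfl) hA1 hS' hA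
  have hTV : ((insert ζ₁ (insert ζ₂ S) ∪ A) ∪ B) ⊆ V := by
    rintro z (((rfl | rfl | hz) | hz) | hz)
    exacts [hAV hA1, hBV hB1, hSV hz, hAV hz, hBV hz]
  have hpB : (-(2 * Complex.I)) ∈ B := by simpa using hB2
  have hpA : (2 * Complex.I) ∈ A := by simpa using hA2
  have hsub := hT.subset_connectedComponentIn (Or.inr hpB) hTV
  have hpc : IsPathConnected (connectedComponentIn V (-(2 * Complex.I))) := by
    rw [← hVo.connectedComponentIn.isConnected_iff_isPathConnected]
    exact isConnected_connectedComponentIn_iff.2 (hBV hpB)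
  obtain ⟨v, hv⟩ := hpc.joinedIn _ (hsub (Or.inr hpB)) _ (hsub (Or.inl (Or.inr hpA)))
  have hvV : ∀ t, v t ∈ V := fun t => connectedComponentIn_subset _ _ (hv t)
  obtain ⟨s, t, hst⟩ := crossing (IccExtend zero_le_one ((Icc (0:ℝ) 1).domRestrict γ)) v.extend
    (Continuous.Icc_extend' (continuousOn_iff_continuous_domRestrict.1 h.cont)) v.continuous_extend
    (by
      intro s
      have : ‖IccExtend zero_le_one ((Icc (0:ℝ) 1).domRestrict γ) s‖ ≤ 1 :=
        h.norm_le (projIcc (0:ℝ) 1 zero_le_one s).2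
      have h3 := (Complex.abs_im_le_norm _).trans this
      linarith)
    (fun t => (hvV (projIcc (0:ℝ) 1 zero_le_one t)).1)
    (by rw [IccExtend_left]; exact h.zero) (by rw [IccExtend_right]; exact h.one)
    (by simp) (by simp)
  refine (hvV (projIcc (0:ℝ) 1 zero_le_one t)).2 ?_
  have e : v.extend t = v (projIcc (0:ℝ) 1 zero_le_one t) := rfl
  rw [← e, ← hst]
  exact ⟨_, (projIcc (0:ℝ) 1 zero_le_one s).2, rfl⟩

lemma sep' {γ : ℝ → ℂ} (h : DPath γ) {S : Set ℂ} (hS : IsPreconnected S)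
    (hSD : S ⊆ ball (0:ℂ) 1 \ γ '' Icc 0 1) {ζ₁ ζ₂ : ℂ} (h1 : ζ₁ ∈ closure S) (h2 : ζ₂ ∈ closure S)
    (n1 : ‖ζ₁‖ = 1) (n2 : ‖ζ₂‖ = 1) (i : ζ₁.im * ζ₂.im < 0) : False := by
  rcases mul_neg_iff.1 i with ⟨a, b⟩ | ⟨a, b⟩
  · exact sep h hS hSD h1 h2 n1 n2 a b
  · exact sep h hS hSD h2 h1 n2 n1 b a

lemma notMem_of_frontier_comp {U : Set ℂ} {x p : ℂ} (hx : x ∈ U)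
    (hp : p ∈ closure (connectedComponentIn U x)) (hp' : p ∉ connectedComponentIn U x) : p ∉ U := by
  intro hpU
  apply hp'
  have : IsPreconnected (insert p (connectedComponentIn U x)) := by
    refine isPreconnected_connectedComponentIn.subset_closure (subset_insert _ _) ?_
    rintro z (rfl | hz)
    exacts [hp, subset_closure hz]
  refine this.subset_connectedComponentIn (Or.inr (mem_connectedComponentIn hx)) ?_ (Or.inl rfl)
  rintro z (rfl | hz)
  exacts [hpU, connectedComponentIn_subset _ _ hz]

/-- Points of `γ₃` cannot be joined to the side of `γ₁` without crossing `γ₁`. -/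
lemma claimB {γ₁ γ₃ : ℝ → ℂ} (h1 : DPath γ₁) (h3 : DPath γ₃) {z₁ z₂ e₁ e₂ ζ : ℂ}
    (hz2 : z₂ ∈ ball (0:ℂ) 1 \ γ₃ '' Icc 0 1)
    (he1 : e₁ ∈ closure (connectedComponentIn (ball (0:ℂ) 1 \ γ₃ '' Icc 0 1) z₁))
    (he2 : e₂ ∈ closure (connectedComponentIn (ball (0:ℂ) 1 \ γ₃ '' Icc 0 1) z₂))
    (n1 : ‖e₁‖ = 1) (n2 : ‖e₂‖ = 1) (i : e₁.im * e₂.im < 0)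
    (hsub : γ₁ '' Icc 0 1 ∩ ball 0 1 ⊆ connectedComponentIn (ball (0:ℂ) 1 \ γ₃ '' Icc 0 1) z₁)
    {T : Set ℂ} (hT : IsPreconnected T) (hTD : T ⊆ ball (0:ℂ) 1 \ γ₁ '' Icc 0 1)
    {s : ℝ} (hs : s ∈ Ioo (0:ℝ) 1) (hsT : γ₃ s ∈ T) (hζ : ζ ∈ closure T) (nζ : ‖ζ‖ = 1)
    (iζ : ζ.im * e₂.im < 0) : False := by
  set D := ball (0:ℂ) 1 \ γ₃ '' Icc 0 1 with hD
  have hDo : IsOpen D := isOpen_ball.sdiff h3.isClosed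
  have hdisj : ∀ z, z ∈ connectedComponentIn D z₁ → z ∈ connectedComponentIn D z₂ → False := by
    intro z a b
    rw [connectedComponentIn_eq a] at he1
    rw [connectedComponentIn_eq b] at he2
    exact sep' h3 isPreconnected_connectedComponentIn (connectedComponentIn_subset _ _) he1 he2 n1 n2 i
  -- a point of γ₃ in the closure of the second component
  obtain ⟨p, hpD, hpc, hpn⟩ : ∃ p ∈ ball (0:ℂ) 1, p ∈ closure (connectedComponentIn D z₂) ∧
      p ∉ connectedComponentIn D z₂ := by
    by_contra! hcon
    have hpre : IsPreconnected (ball (0:ℂ) 1) := (convex_ball _ _).isPreconnected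
    have hss : ball (0:ℂ) 1 ⊆ connectedComponentIn D z₂ := by
      refine (hpre.subset_or_subset (v := (closure (connectedComponentIn D z₂))ᶜ)
        hDo.connectedComponentIn isClosed_closure.isOpen_compl
        (disjoint_compl_right.mono_left subset_closure) ?_).resolve_right ?_
      · intro z hz
        by_cases hc : z ∈ closure (connectedComponentIn D z₂)
        · exact Or.inl (hcon z hz hc)
        · exact Or.inr hc
      · intro hh
        exact hh hz2.1 (subset_closure (mem_connectedComponentIn hz2))
    exact (connectedComponentIn_subset _ _ (hss (h3.mem s hs))).2 ⟨s, Ioo_subset_Icc_self hs, rfl⟩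
  have hp3 : p ∈ γ₃ '' Icc 0 1 := by
    by_contra hc
    exact notMem_of_frontier_comp hz2 hpc hpn ⟨hpD, hc⟩
  have hp3' : p ∈ γ₃ '' Ioo 0 1 := by
    obtain ⟨t, ht, rfl⟩ := hp3
    rw [mem_ball_zero_iff] at hpD
    rcases h3.cases ht with h | h | ⟨h, -⟩
    · simp [h] at hpD
    · simp [h] at hpD
    · exact ⟨t, h, rfl⟩
  have hK2 : IsPreconnected (insert p (connectedComponentIn D z₂)) := by
    refine isPreconnected_connectedComponentIn.subset_closure (subset_insert _ _) ?_
    rintro z (rfl | hz)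
    exacts [hpc, subset_closure hz]
  have h31 : ∀ t ∈ Ioo (0:ℝ) 1, γ₃ t ∈ ball (0:ℂ) 1 \ γ₁ '' Icc 0 1 := by
    intro t ht
    refine ⟨h3.mem t ht, fun hc => ?_⟩
    exact (connectedComponentIn_subset _ _ (hsub ⟨hc, h3.mem t ht⟩)).2
      ⟨t, Ioo_subset_Icc_self ht, rfl⟩
  have hg3 : IsPreconnected (γ₃ '' Ioo 0 1) :=
    isPreconnected_Ioo.image _ (h3.cont.mono Ioo_subset_Icc_self)
  have hall : IsPreconnected ((T ∪ γ₃ '' Ioo 0 1) ∪ insert p (connectedComponentIn D z₂)) := by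
    refine IsPreconnected.union p (Or.inr hp3') (Or.inl rfl) ?_ hK2
    exact IsPreconnected.union (γ₃ s) hsT ⟨s, hs, rfl⟩ hT hg3
  refine sep' h1 hall ?_ (ζ₁ := ζ) (ζ₂ := e₂) ?_ ?_ nζ n2 iζ
  · rintro z ((hz | ⟨t, ht, rfl⟩) | rfl | hz)
    · exact hTD hz
    · exact h31 t ht
    · obtain ⟨t, ht, rfl⟩ := hp3'
      exact h31 t ht
    · have hzD := connectedComponentIn_subset _ _ hz
      exact ⟨hzD.1, fun hc => hdisj z (hsub ⟨hc, hzD.1⟩) hz⟩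
  · exact closure_mono (fun z hz => Or.inl (Or.inl hz)) hζ
  · exact closure_mono (fun z hz => Or.inr (Or.inr hz)) he2

lemma near_one {γ : ℝ → ℂ} (h : DPath γ) {g : ℂ → ℂ}
    (hg : Tendsto (fun s => g (γ s)) (nhdsWithin 1 (Iio 1)) (nhds 0)) {ε : ℝ} (hε : 0 < ε) :
    ∃ δ > 0, ∀ s ∈ Ioo (0:ℝ) 1, ‖γ s - 1‖ < δ → ‖g (γ s)‖ ≤ ε := by
  have h1 : ∀ᶠ s in nhdsWithin (1:ℝ) (Iio 1), ‖g (γ s)‖ < ε := by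
    have := hg.norm
    rw [norm_zero] at this
    exact this.eventually_lt_const hε
  obtain ⟨a, ha, ha'⟩ := (mem_nhdsLT_iff_exists_Ioo_subset).1 h1
  have hcl : IsClosed (γ '' Icc 0 (max a 0)) := by
    refine (isCompact_Icc.image_of_continuousOn (h.cont.mono ?_)).isClosed
    exact Icc_subset_Icc le_rfl (max_le (le_of_lt ha) zero_le_one)
  have hno : (1:ℂ) ∈ (γ '' Icc 0 (max a 0))ᶜ := by
    rintro ⟨s, hs, hs1⟩
    have hs2 : s < 1 := hs.2.trans_lt (max_lt ha zero_lt_one)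
    rcases h.cases ⟨hs.1, hs2.le⟩ with h' | h' | ⟨-, h'⟩
    · rw [h'] at hs1; norm_num at hs1
    · rcases eq_or_lt_of_le hs.1 with rfl | h0
      · rw [h.zero] at hs1; norm_num at hs1
      · have := h.mem s ⟨h0, hs2⟩
        rw [hs1] at this
        simp at this
    · rw [hs1] at h'; simp at h'
  obtain ⟨δ, hδ, hball⟩ := Metric.isOpen_iff.1 hcl.isOpen_compl 1 hno
  refine ⟨δ, hδ, fun s hs hsd => ?_⟩
  by_cases hsa : a < s
  · exact le_of_lt (ha' ⟨hsa, hs.2⟩)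
  · exfalso
    refine hball (by rwa [mem_ball, dist_eq_norm]) ⟨s, ⟨hs.1.le, ?_⟩, rfl⟩
    exact (not_lt.1 hsa).trans (le_max_left _ _)

/-- Maximum principle with one exceptional boundary point `1`. -/
lemma max_exceptional {U : Set ℂ} (hUo : IsOpen U) (hU : U ⊆ ball (0:ℂ) 1)
    (hcl : closure U ⊆ insert 1 (ball (0:ℂ) 1))
    {G : ℂ → ℂ} (hG : DifferentiableOn ℂ G (ball (0:ℂ) 1)) {M ε : ℝ} (hε : 0 < ε)
    (hM : ∀ z ∈ ball (0:ℂ) 1, ‖G z‖ ≤ M)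
    (hfr : ∀ z ∈ frontier U, z ≠ 1 → ‖G z‖ ≤ ε) {z : ℂ} (hz : z ∈ U) : ‖G z‖ ≤ ε := by
  have key : ∀ n : ℕ, ‖G z‖ ^ n * ‖1 - z‖ ≤ 2 * ε ^ n := by
    intro n
    have hd : DiffContOnCl ℂ (fun w => G w ^ n * (1 - w)) U := by
      refine ⟨((hG.mono hU).pow n).mul (by fun_prop), ?_⟩
      intro w hw
      rcases hcl hw with rfl | hwD
      · have hle : ∀ x ∈ closure U, ‖G x ^ n * (1 - x)‖ ≤ M ^ n * ‖1 - x‖ := by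
          intro x hx
          rcases hcl hx with rfl | hxD
          · simp
          · rw [norm_mul, norm_pow]
            gcongr
            exact hM x hxD
        unfold ContinuousWithinAt
        simp only [sub_self, mul_zero]
        refine squeeze_zero_norm' (eventually_nhdsWithin_of_forall hle) ?_
        have : Tendsto (fun x : ℂ => M ^ n * ‖1 - x‖) (nhds 1) (nhds (M ^ n * ‖(1:ℂ) - 1‖)) :=
          Continuous.tendsto (by fun_prop) 1
        simp only [sub_self, norm_zero, mul_zero] at this
        exact this.mono_left nhdsWithin_le_nhds
      · have : ContinuousAt G w := (hG.differentiableAt (isOpen_ball.mem_nhds hwD)).continuousAt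
        exact ((this.pow n).mul (by fun_prop)).continuousWithinAt
    have := Complex.norm_le_of_forall_mem_frontier_norm_le (isBounded_ball.subset hU) hd
      (C := 2 * ε ^ n) ?_ (subset_closure hz)
    · rwa [norm_mul, norm_pow] at this
    · intro w hw
      by_cases hw1 : w = 1
      · subst hw1
        simp; positivity
      · have hwD := (hcl (frontier_subset_closure hw)).resolve_left hw1
        rw [norm_mul, norm_pow, mul_comm]
        rw [mem_ball_zero_iff] at hwD
        have : ‖1 - w‖ ≤ 2 := by
          refine (norm_sub_le _ _).trans ?_
          rw [norm_one]; linarith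
        gcongr
        exact hfr w hw hw1
  by_contra! hlt
  have hz1 : 0 < ‖1 - z‖ := by
    rw [norm_pos_iff, sub_ne_zero]
    rintro rfl
    have := hU hz
    simp at this
  have hr : 1 < ‖G z‖ / ε := by rwa [one_lt_div hε]
  obtain ⟨n, hn⟩ := pow_unbounded_of_one_lt (2 / ‖1 - z‖) hr
  rw [div_pow, div_lt_div_iff₀ hz1 (by positivity)] at hn
  linarith [key n]

lemma main_tendsto {γ₁ γ₂ γ₃ : ℝ → ℂ} (h1 : DPath γ₁) (h2 : DPath γ₂) (h3 : DPath γ₃)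
    {g : ℂ → ℂ} (hg : DifferentiableOn ℂ g (ball (0:ℂ) 1)) {M : ℝ}
    (hM : ∀ z ∈ ball (0:ℂ) 1, ‖g z‖ ≤ M)
    (t1 : Tendsto (fun s => g (γ₁ s)) (nhdsWithin 1 (Iio 1)) (nhds 0))
    (t2 : Tendsto (fun s => g (γ₂ s)) (nhdsWithin 1 (Iio 1)) (nhds 0))
    (hdis : ∀ s ∈ Ioo (0:ℝ) 1, γ₃ s ∉ γ₁ '' Icc 0 1 ∪ γ₂ '' Icc 0 1)
    (htop : ∀ s ∈ Ioo (0:ℝ) 1, ∀ T : Set ℂ, IsPreconnected T →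
      T ⊆ ball (0:ℂ) 1 \ (γ₁ '' Icc 0 1 ∪ γ₂ '' Icc 0 1) → γ₃ s ∈ T → ∀ ζ ∈ closure T,
      ‖ζ‖ = 1 → ζ.im = 0) :
    Tendsto (fun s => g (γ₃ s)) (nhdsWithin 1 (Iio 1)) (nhds 0) := by
  rw [NormedAddCommGroup.tendsto_nhds_zero]
  intro ε' hε'
  set ε := ε' / 2 with hεdef
  have hε : 0 < ε := by positivity
  obtain ⟨δ₁, hδ₁, H1⟩ := near_one h1 t1 hε
  obtain ⟨δ₂, hδ₂, H2⟩ := near_one h2 t2 hε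
  obtain ⟨δ, hδ, hδle⟩ : ∃ δ > 0, δ ≤ δ₁ ∧ δ ≤ δ₂ ∧ δ ≤ 1 :=
    ⟨min δ₁ (min δ₂ 1), by positivity, by simp, by simp, by simp⟩
  obtain ⟨c, hc0, hc⟩ : ∃ c : ℝ, 0 ≤ c ∧ M * Real.exp (-(c * (δ ^ 2 / 2))) ≤ ε := by
    have : Tendsto (fun c : ℝ => M * Real.exp (-(c * (δ ^ 2 / 2)))) atTop (nhds (M * 0)) := by
      refine Tendsto.const_mul _ (Real.tendsto_exp_neg_atTop_nhds_zero.comp ?_)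
      exact tendsto_id.atTop_mul_const (by positivity)
    rw [mul_zero] at this
    obtain ⟨c, h, h'⟩ := ((this.eventually_le_const hε).and (eventually_ge_atTop 0)).exists
    exact ⟨c, h', h⟩
  let G : ℂ → ℂ := fun z => g z * Complex.exp (-(c * (1 - z)))
  have hGn : ∀ z, ‖G z‖ = ‖g z‖ * Real.exp (-(c * (1 - z.re))) := by
    intro z
    simp only [G, norm_mul, Complex.norm_exp]
    simp
  have hGd : DifferentiableOn ℂ G (ball (0:ℂ) 1) := hg.mul (by fun_prop)
  have hre : ∀ z ∈ ball (0:ℂ) 1, ‖z - 1‖ ^ 2 / 2 ≤ 1 - z.re := by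
    intro z hz
    rw [mem_ball_zero_iff] at hz
    have a := Complex.sq_norm z
    have b := Complex.sq_norm (z - 1)
    rw [Complex.normSq_apply] at a b
    simp at b
    nlinarith [norm_nonneg z]
  have hre0 : ∀ z ∈ ball (0:ℂ) 1, 0 ≤ 1 - z.re := fun z hz => le_trans (by positivity) (hre z hz)
  have hGg : ∀ z ∈ ball (0:ℂ) 1, ‖G z‖ ≤ ‖g z‖ := by
    intro z hz
    rw [hGn]
    refine mul_le_of_le_one_right (norm_nonneg _) (Real.exp_le_one_iff.2 ?_)
    have := mul_nonneg hc0 (hre0 z hz)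
    linarith
  -- the key bound
  have key : ∀ s ∈ Ioo (0:ℝ) 1, ‖γ₃ s - 1‖ < δ → ‖G (γ₃ s)‖ ≤ ε := by
    intro s hs hsδ
    set E := γ₁ '' Icc 0 1 ∪ γ₂ '' Icc 0 1 with hE
    set W := (ball (0:ℂ) 1 ∩ ball 1 δ) \ E with hW
    have hWo : IsOpen W := (isOpen_ball.inter isOpen_ball).sdiff (h1.isClosed.union h2.isClosed)
    have hsW : γ₃ s ∈ W := ⟨⟨h3.mem s hs, by rwa [mem_ball, dist_eq_norm]⟩, hdis s hs⟩
    have hUW := connectedComponentIn_subset W (γ₃ s)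
    have hcl : closure (connectedComponentIn W (γ₃ s)) ⊆ insert 1 (ball (0:ℂ) 1) := by
      intro z hz
      have hz1 : z ∈ closedBall (0:ℂ) 1 := closure_ball_subset_closedBall
        (closure_mono (fun w hw => (hUW hw).1.1) hz)
      have hz2 : z ∈ closedBall (1:ℂ) δ := closure_ball_subset_closedBall
        (closure_mono (fun w hw => (hUW hw).1.2) hz)
      rw [mem_closedBall_zero_iff] at hz1
      rcases eq_or_lt_of_le hz1 with hz1 | hz1
      · left
        have him := htop s hs _ isPreconnected_connectedComponentIn
          (fun w hw => ⟨(hUW hw).1.1, (hUW hw).2⟩) (mem_connectedComponentIn hsW) z hz hz1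
        rw [mem_closedBall, dist_eq_norm] at hz2
        have a := Complex.sq_norm z
        rw [hz1, Complex.normSq_apply, him] at a
        have b := (Complex.abs_re_le_norm (z - 1)).trans hz2
        rw [Complex.sub_re, Complex.one_re, abs_le] at b
        have : (z.re - 1) * (z.re + 1) = 0 := by linarith
        rcases mul_eq_zero.1 this with h | h
        · apply Complex.ext
          · simp; linarith
          · simpa using him
        · linarith
      · right
        simpa using hz1
    refine max_exceptional hWo.connectedComponentIn (fun w hw => (hUW hw).1.1) hcl hGd hε
      (fun z hz => (hGg z hz).trans (hM z hz)) ?_ (mem_connectedComponentIn hsW)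
    intro z hz hz1
    have hzcl := frontier_subset_closure hz
    have hzD : z ∈ ball (0:ℂ) 1 := (hcl hzcl).resolve_left hz1
    have hzn : z ∉ connectedComponentIn W (γ₃ s) := by
      rw [hWo.connectedComponentIn.frontier_eq] at hz
      exact hz.2
    have hzW : z ∉ W := notMem_of_frontier_comp hsW hzcl hzn
    by_cases hzδ : ‖z - 1‖ < δ
    · have hzE : z ∈ E := by
        by_contra hc
        exact hzW ⟨⟨hzD, by rwa [mem_ball, dist_eq_norm]⟩, hc⟩
      refine (hGg z hzD).trans ?_
      have hzD' := mem_ball_zero_iff.1 hzD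
      rcases hzE with ⟨t, ht, rfl⟩ | ⟨t, ht, rfl⟩
      · rcases h1.cases ht with h | h | ⟨h, -⟩
        · simp [h] at hzD'
        · simp [h] at hzD'
        · exact H1 t h (hzδ.trans_le hδle.1)
      · rcases h2.cases ht with h | h | ⟨h, -⟩
        · simp [h] at hzD'
        · simp [h] at hzD'
        · exact H2 t h (hzδ.trans_le hδle.2.1)
    · push Not at hzδ
      rw [hGn]
      have hM0 : 0 ≤ M := (norm_nonneg _).trans (hM z hzD)
      refine le_trans ?_ hc
      have h4 : δ ^ 2 / 2 ≤ 1 - z.re := le_trans (by gcongr) (hre z hzD)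
      gcongr
      exact hM z hzD
  have hγ : Tendsto γ₃ (nhdsWithin 1 (Iio 1)) (nhds 1) := by
    have := (h3.cont 1 (by simp)).tendsto
    rw [h3.one] at this
    refine this.mono_left ?_
    rw [← nhdsWithin_Ioo_eq_nhdsLT (zero_lt_one (α := ℝ))]
    exact nhdsWithin_mono _ Ioo_subset_Icc_self
  have e1 : ∀ᶠ s in nhdsWithin (1:ℝ) (Iio 1), ‖γ₃ s - 1‖ < δ := by
    have := (hγ.sub_const 1).norm
    simp only [sub_self, norm_zero] at this
    exact this.eventually_lt_const hδ
  have e2 : ∀ᶠ s in nhdsWithin (1:ℝ) (Iio 1), ε * Real.exp (c * (1 - (γ₃ s).re)) < ε' := by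
    have h4 : Continuous (fun z : ℂ => ε * Real.exp (c * (1 - z.re))) := by fun_prop
    have := (h4.tendsto 1).comp hγ
    simp only [Complex.one_re, sub_self, mul_zero, Real.exp_zero, mul_one] at this
    exact this.eventually_lt_const (by linarith)
  have e3 : ∀ᶠ s in nhdsWithin (1:ℝ) (Iio 1), s ∈ Ioo (0:ℝ) 1 := Ioo_mem_nhdsLT zero_lt_one
  filter_upwards [e1, e2, e3] with s s1 s2 s3
  refine lt_of_le_of_lt ?_ s2
  have := key s s3 s1
  rw [hGn, Real.exp_neg, ← div_eq_mul_inv, div_le_iff₀ (Real.exp_pos _)] at this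
  exact this

lemma converges_of_prod {γ : ℝ → ℂ} {L₁ L₂ : ℂ} (hγ : ContinuousOn γ (Ioo 0 1))
    (h : Tendsto (fun s => (γ s - L₁) * (γ s - L₂)) (nhdsWithin 1 (Iio 1)) (nhds 0)) :
    ∃ L, Tendsto γ (nhdsWithin 1 (Iio 1)) (nhds L) := by
  have hn := h.norm
  simp only [norm_mul, norm_zero] at hn
  by_cases hL : L₁ = L₂
  · subst hL
    refine ⟨L₁, tendsto_iff_norm_sub_tendsto_zero.2 ?_⟩
    have := hn.sqrt
    simpa using this
  have hd : 0 < ‖L₁ - L₂‖ := norm_pos_iff.2 (sub_ne_zero.2 hL)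
  set d := ‖L₁ - L₂‖ with hdd
  obtain ⟨a, ha, ha'⟩ := (mem_nhdsLT_iff_exists_Ioo_subset).1
    ((hn.eventually_lt_const (show 0 < (d/2)*(d/2) by positivity)).and
      (Ioo_mem_nhdsLT (zero_lt_one (α := ℝ))))
  have hpre : IsPreconnected (γ '' Ioo a 1) :=
    isPreconnected_Ioo.image _ (hγ.mono (fun s hs => (ha' hs).2))
  have htri : ∀ z : ℂ, d ≤ ‖z - L₁‖ + ‖z - L₂‖ := by
    intro z
    have : L₁ - L₂ = (z - L₂) - (z - L₁) := by ring
    rw [hdd, this, add_comm]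
    exact norm_sub_le _ _
  have hdisj : Disjoint (ball L₁ (d/2)) (ball L₂ (d/2)) := by
    rw [Set.disjoint_left]
    intro z h1 h2
    rw [mem_ball, dist_eq_norm] at h1 h2
    linarith [htri z]
  have hev : ∀ᶠ s in nhdsWithin (1:ℝ) (Iio 1), s ∈ Ioo a 1 := Ioo_mem_nhdsLT ha
  have hn2 : Tendsto (fun s => (2 / d) * (‖γ s - L₁‖ * ‖γ s - L₂‖)) (nhdsWithin 1 (Iio 1))
      (nhds 0) := by
    have := hn.const_mul (2 / d)
    rwa [mul_zero] at this
  rcases hpre.subset_or_subset isOpen_ball isOpen_ball hdisj (by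
    rintro _ ⟨s, hs, rfl⟩
    by_contra hc
    simp only [mem_union, mem_ball, dist_eq_norm, not_or, not_lt] at hc
    have h1 := (ha' hs).1
    have h2 := mul_le_mul hc.1 hc.2 (by positivity) (by positivity)
    exact absurd h1 (not_lt.2 h2)) with hs | hs
  · refine ⟨L₁, tendsto_iff_norm_sub_tendsto_zero.2 ?_⟩
    refine squeeze_zero' (Eventually.of_forall fun _ => norm_nonneg _) ?_ hn2
    filter_upwards [hev] with s h5
    have h6 := hs ⟨s, h5, rfl⟩
    rw [mem_ball, dist_eq_norm] at h6
    have h7 : d / 2 ≤ ‖γ s - L₂‖ := by linarith [htri (γ s)]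
    calc ‖γ s - L₁‖ = (2 / d) * (‖γ s - L₁‖ * (d / 2)) := by field_simp
      _ ≤ _ := by gcongr
  · refine ⟨L₂, tendsto_iff_norm_sub_tendsto_zero.2 ?_⟩
    refine squeeze_zero' (Eventually.of_forall fun _ => norm_nonneg _) ?_ hn2
    filter_upwards [hev] with s h5
    have h6 := hs ⟨s, h5, rfl⟩
    rw [mem_ball, dist_eq_norm] at h6
    have h7 : d / 2 ≤ ‖γ s - L₁‖ := by linarith [htri (γ s)]
    calc ‖γ s - L₂‖ = (2 / d) * ((d / 2) * ‖γ s - L₂‖) := by field_simp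
      _ ≤ _ := by gcongr

/-- If a bounded analytic function `f` on the unit disk diverges along a path
`γ₃` from `-1` to `1`, then either the region above `γ₃` (the connected component of
`𝔻 \ γ₃` with `i` in its closure) or the region below `γ₃` (the component with `-i` in its
closure) is a path divergence set for `f` at `1`. -/
theorem path_divergence_above_or_below
    (f : ℂ → ℂ)
    (hf : DifferentiableOn ℂ f (ball (0:ℂ) 1))
    (hb : ∃ C : ℝ, ∀ z ∈ ball (0:ℂ) 1, ‖f z‖ ≤ C)
    (γ₃ : ℝ → ℂ)
    (hγc : ContinuousOn γ₃ (Icc 0 1)) (hγ0 : γ₃ 0 = -1) (hγ1 : γ₃ 1 = 1)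
    (hγD : ∀ s ∈ Ioo (0:ℝ) 1, γ₃ s ∈ ball (0:ℂ) 1)
    (hdiv : ¬ ∃ L : ℂ, Tendsto (fun s => f (γ₃ s)) (nhdsWithin 1 (Iio 1)) (nhds L))
    (Kab Kbel : Set ℂ)
    (hKab : ∃ z ∈ ball (0:ℂ) 1 \ (γ₃ '' Icc 0 1),
      Kab = connectedComponentIn (ball (0:ℂ) 1 \ (γ₃ '' Icc 0 1)) z)
    (hKabI : Complex.I ∈ closure Kab)
    (hKbel : ∃ z ∈ ball (0:ℂ) 1 \ (γ₃ '' Icc 0 1),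
      Kbel = connectedComponentIn (ball (0:ℂ) 1 \ (γ₃ '' Icc 0 1)) z)
    (hKbelI : -Complex.I ∈ closure Kbel) :
    IsPathDivergenceSet f Kab ∨ IsPathDivergenceSet f Kbel := by
  by_contra hcon
  rw [not_or] at hcon
  obtain ⟨hA, hB⟩ := hcon
  simp only [IsPathDivergenceSet, not_forall, not_not] at hA hB
  obtain ⟨γ₁, c1, z1, o1, m1, s1, L₁, l1⟩ := hA
  obtain ⟨γ₂, c2, z2, o2, m2, s2, L₂, l2⟩ := hB
  have h1 : DPath γ₁ := ⟨c1, z1, o1, m1⟩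
  have h2 : DPath γ₂ := ⟨c2, z2, o2, m2⟩
  have h3 : DPath γ₃ := ⟨hγc, hγ0, hγ1, hγD⟩
  obtain ⟨za, hza, rfl⟩ := hKab
  obtain ⟨zb, hzb, rfl⟩ := hKbel
  obtain ⟨C, hC⟩ := hb
  apply hdiv
  refine converges_of_prod (L₁ := L₁) (L₂ := L₂) (hf.continuousOn.comp
    (hγc.mono Ioo_subset_Icc_self) hγD) ?_
  refine main_tendsto (g := fun z => (f z - L₁) * (f z - L₂)) (M := (C + ‖L₁‖) * (C + ‖L₂‖))
    h1 h2 h3 ((hf.sub_const _).mul (hf.sub_const _)) ?_ ?_ ?_ ?_ ?_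
  · intro z hz
    rw [norm_mul]
    have a1 := (norm_sub_le (f z) L₁).trans (add_le_add_left (hC z hz) _)
    have a2 := (norm_sub_le (f z) L₂).trans (add_le_add_left (hC z hz) _)
    exact mul_le_mul a1 a2 (norm_nonneg _) ((norm_nonneg _).trans a1)
  · simpa using (l1.sub_const L₁).mul (l1.sub_const L₂)
  · simpa using (l2.sub_const L₁).mul (l2.sub_const L₂)
  · rintro s hs (h | h)
    · exact (connectedComponentIn_subset _ _ (s1 ⟨h, hγD s hs⟩)).2
        ⟨s, Ioo_subset_Icc_self hs, rfl⟩
    · exact (connectedComponentIn_subset _ _ (s2 ⟨h, hγD s hs⟩)).2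
        ⟨s, Ioo_subset_Icc_self hs, rfl⟩
  · intro s hs T hT hTD hsT ζ hζ nζ
    by_contra him
    rcases lt_or_gt_of_ne him with hlt | hgt
    · exact claimB h2 h3 (e₁ := -Complex.I) (e₂ := Complex.I) hza hKbelI hKabI (by simp) (by simp)
        (by simp) s2 hT (fun z hz => ⟨(hTD hz).1, fun h => (hTD hz).2 (Or.inr h)⟩) hs hsT hζ nζ
        (by simpa using hlt)
    · exact claimB h1 h3 (e₁ := Complex.I) (e₂ := -Complex.I) hzb hKabI hKbelI (by simp) (by simp)
        (by simp) s1 hT (fun z hz => ⟨(hTD hz).1, fun h => (hTD hz).2 (Or.inl h)⟩) hs hsT hζ nζ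
        (by simpa using hgt)
end

section
/- Let $E_1$ and $E_2$ be disjoint circles in $\mathbb{C}$ (i.e., sets of the form $\{z : |z-c_j|=r_j\}$ with $r_j>0$, having empty intersection), and let $\gamma:[0,1]\to\mathbb{C}$ be any continuous path. Then only finitely many of the connected components of $\mathbb{C}\setminus\gamma([0,1])$ intersect both $E_1$ and $E_2$. -/
open Set Metric

/-- `f` has a continuous logarithm on `K`. -/
def HasContLog (K : Set ℂ) (f : ℂ → ℂ) : Prop :=
  ∃ h : ℂ → ℂ, ContinuousOn h K ∧ ∀ z ∈ K, Complex.exp (h z) = f z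

lemma exp_one_const {X : Type*} [TopologicalSpace X] {S : Set X} (hS : IsPreconnected S)
    {u : X → ℂ} (hu : ContinuousOn u S) (h1 : ∀ x ∈ S, Complex.exp (u x) = 1) :
    ∃ n : ℤ, ∀ x ∈ S, u x = n * (2 * Real.pi * Complex.I) := by
  rcases S.eq_empty_or_nonempty with rfl | ⟨x0, hx0⟩
  · exact ⟨0, by simp⟩
  obtain ⟨n, hn⟩ := Complex.exp_eq_one_iff.1 (h1 x0 hx0)
  refine ⟨n, fun x hx => ?_⟩
  rw [← hn]
  refine hS.induction₂ (fun a b => u a = u b) ?_ (fun _ _ _ _ _ _ h h' => h.trans h')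
    (fun _ _ _ _ h => h.symm) hx hx0
  intro a ha
  have := (Metric.continuousWithinAt_iff'.1 (hu a ha)) 1 one_pos
  filter_upwards [this, self_mem_nhdsWithin] with b hb hbS
  obtain ⟨k, hk⟩ := Complex.exp_eq_one_iff.1 (h1 a ha)
  obtain ⟨l, hl⟩ := Complex.exp_eq_one_iff.1 (h1 b hbS)
  have e : u b - u a = ((l - k : ℤ) : ℂ) * (2 * Real.pi * Complex.I) := by
    rw [hk, hl]; push_cast; ring
  rw [dist_eq_norm, e, norm_mul, Complex.norm_intCast] at hb
  have h2 : ‖(2 * Real.pi * Complex.I : ℂ)‖ = 2 * Real.pi := by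
    simp [abs_of_pos Real.pi_pos]
  rw [h2] at hb
  have hlk : l - k = 0 := by
    by_contra hne
    have : (1 : ℝ) ≤ |((l - k : ℤ) : ℝ)| := by exact_mod_cast Int.one_le_abs hne
    nlinarith [Real.pi_gt_three]
  have : l = k := by omega
  rw [hk, hl, this]

lemma hasContLog_near {K : Set ℂ} (c : ℂ → ℂ) (hc : ContinuousOn c K)
    (hlt : ∀ z ∈ K, ‖c z‖ < 1) : HasContLog K (fun z => 1 + c z) := by
  refine ⟨fun z => Complex.log (1 + c z), ?_, fun z hz => ?_⟩
  · exact (continuousOn_const.add hc).clog fun z hz =>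
      Complex.mem_slitPlane_of_norm_lt_one (hlt z hz)
  · exact Complex.exp_log (Complex.slitPlane_ne_zero
      (Complex.mem_slitPlane_of_norm_lt_one (hlt z hz)))

lemma hasContLog_conn {K S : Set ℂ} (hK : IsClosed K) (hS : IsPreconnected S)
    (hSK : S ⊆ Kᶜ) {p q : ℂ} (hp : p ∈ S) (hq : q ∈ S) :
    HasContLog K (fun z => (z - p) / (z - q)) := by
  have hne : ∀ x ∈ S, ∀ z ∈ K, z - x ≠ 0 := fun x hx z hz h =>
    hSK hx (by rwa [← sub_eq_zero.1 h])
  refine hS.induction₂ (fun p q => HasContLog K (fun z => (z - p) / (z - q))) ?_ ?_ ?_ hp hq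
  · intro x hx
    obtain ⟨ε, hε, hb⟩ := Metric.isOpen_iff.1 hK.isOpen_compl x (hSK hx)
    have hd : ∀ z ∈ K, ε ≤ ‖z - x‖ := by
      intro z hz
      by_contra! h
      exact hb (by rwa [mem_ball, dist_eq_norm]) hz
    have : ball x (ε / 2) ∈ nhdsWithin x S := mem_nhdsWithin_of_mem_nhds (ball_mem_nhds _ (by positivity))
    filter_upwards [this, self_mem_nhdsWithin] with y hy hyS
    rw [mem_ball, dist_eq_norm] at hy
    have := hasContLog_near (K := K) (fun z => (y - x) / (z - y)) (by
      refine continuousOn_const.div (by fun_prop) (hne y hyS)) (by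
      intro z hz
      have h1 := hd z hz
      have h2 : ‖z - x‖ ≤ ‖z - y‖ + ‖y - x‖ := by
        simpa using norm_add_le (z - y) (y - x)
      rw [norm_div, div_lt_one (by linarith)]
      linarith)
    obtain ⟨h, hc, he⟩ := this
    refine ⟨h, hc, fun z hz => ?_⟩
    rw [he z hz]
    have := hne y hyS z hz
    field_simp
    ring
  · rintro x y w hx hy hw ⟨h, hc, he⟩ ⟨h', hc', he'⟩
    refine ⟨fun z => h z + h' z, hc.add hc', fun z hz => ?_⟩
    rw [Complex.exp_add, he z hz, he' z hz]
    have := hne y hy z hz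
    have := hne w hw z hz
    field_simp
  · rintro x y hx hy ⟨h, hc, he⟩
    refine ⟨fun z => - h z, hc.neg, fun z hz => ?_⟩
    rw [Complex.exp_neg, he z hz, inv_div]

lemma entire_log {G : ℂ → ℂ} (hG : Continuous G) (h0 : ∀ z, G z ≠ 0) :
    ∃ L : ℂ → ℂ, Continuous L ∧ ∀ z, Complex.exp (L z) = G z := by
  rcases Complex.isCoveringMapOn_exp.existsUnique_continuousMap_lifts
    ⟨G, hG⟩ (a₀ := 0) (Complex.exp_log (h0 0)) (fun x ↦ h0 x) with ⟨f, ⟨-, hf⟩, -⟩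
  exact ⟨f, f.continuous, fun z => congrFun hf z⟩

lemma winding_zero {p : ℂ} {n : ℤ} {R : ℝ} (hR : 0 < R) {L : ℂ → ℂ} (hL : Continuous L)
    (h : ∀ z, ‖z - p‖ = R → Complex.exp (L z) = (z - p) ^ n) : n = 0 := by
  let w : ℝ → ℂ := fun t => p + R * Complex.exp (t * Complex.I)
  have hw : Continuous w := by fun_prop
  have hRc : (R : ℂ) ≠ 0 := by exact_mod_cast hR.ne'
  let u : ℝ → ℂ := fun t => L (w t) - L (w 0) - n * (t * Complex.I)
  have hu : Continuous u := by fun_prop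
  have hwn : ∀ t, ‖w t - p‖ = R := by
    intro t
    simp [w, Complex.norm_exp_ofReal_mul_I, abs_of_pos hR]
  have he : ∀ t, Complex.exp (u t) = 1 := by
    intro t
    simp only [u]
    rw [Complex.exp_sub, Complex.exp_sub, h _ (hwn t), h _ (hwn 0), Complex.exp_int_mul]
    simp only [w, add_sub_cancel_left, mul_zpow]
    have h1 : (R : ℂ) ^ n ≠ 0 := zpow_ne_zero _ hRc
    have h2 : Complex.exp (t * Complex.I) ^ n ≠ 0 := zpow_ne_zero _ (Complex.exp_ne_zero _)
    simp
    field_simp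
  obtain ⟨k, hk⟩ := exp_one_const isPreconnected_univ hu.continuousOn (fun t _ => he t)
  have e0 := hk 0 trivial
  have e1 := hk (2 * Real.pi) trivial
  have hw1 : w (2 * Real.pi) = w 0 := by
    simp [w, Complex.exp_two_pi_mul_I]
  simp only [u, hw1] at e0 e1
  have : (n : ℂ) * (2 * Real.pi * Complex.I) = 0 := by
    push_cast at e0 e1
    linear_combination e0 - e1
  have := (mul_eq_zero.1 this).resolve_right Complex.two_pi_I_ne_zero
  exact_mod_cast this

lemma closure_comp {K : Set ℂ} (hK : IsClosed K) {p : ℂ} {x : ℂ}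
    (hx : x ∈ closure (connectedComponentIn Kᶜ p)) (hxK : x ∉ K) :
    x ∈ connectedComponentIn Kᶜ p := by
  have ho : IsOpen (connectedComponentIn Kᶜ x) := hK.isOpen_compl.connectedComponentIn
  obtain ⟨y, hy1, hy2⟩ := mem_closure_iff.1 hx _ ho (mem_connectedComponentIn hxK)
  rw [connectedComponentIn_eq hy2, ← connectedComponentIn_eq hy1]
  exact mem_connectedComponentIn hxK

lemma eilenberg {K : Set ℂ} (hK : IsClosed K) {ι : Type*} [Fintype ι]
    (p : ι → ℂ) (c : ι → ℤ) (hp : ∀ i, p i ∉ K) (i₀ : ι)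
    (hb : Bornology.IsBounded (connectedComponentIn Kᶜ (p i₀)))
    (hj : ∀ j, j ≠ i₀ → p j ∉ connectedComponentIn Kᶜ (p i₀))
    (hlog : HasContLog K (fun z => ∏ i, (z - p i) ^ c i)) : c i₀ = 0 := by
  classical
  obtain ⟨h, hc, he⟩ := hlog
  obtain ⟨H, hH⟩ := ContinuousMap.exists_restrict_eq hK (⟨K.domRestrict h,
    continuousOn_iff_continuous_domRestrict.mp hc⟩ : C(K, ℂ))
  have hHK : ∀ z ∈ K, H z = h z := fun z hz => DFunLike.congr_fun hH ⟨z, hz⟩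
  set U := connectedComponentIn Kᶜ (p i₀) with hU
  have hpU : p i₀ ∈ U := mem_connectedComponentIn (hp i₀)
  have hUo : IsOpen U := hK.isOpen_compl.connectedComponentIn
  let A : ℂ → ℂ := fun z => Complex.exp (H z) / ∏ j ∈ Finset.univ.erase i₀, (z - p j) ^ c j
  let B : ℂ → ℂ := fun z => (z - p i₀) ^ c i₀
  have hcl : ∀ z ∈ closure U, ∀ j, j ≠ i₀ → z - p j ≠ 0 := by
    intro z hz j hji h0
    rw [sub_eq_zero.1 h0] at hz
    exact hj j hji (closure_comp hK hz (hp j))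
  have hprod : ∀ z ∈ closure U, ∏ j ∈ Finset.univ.erase i₀, (z - p j) ^ c j ≠ 0 := by
    intro z hz
    exact Finset.prod_ne_zero_iff.2 fun j hj' => zpow_ne_zero _ (hcl z hz j (Finset.ne_of_mem_erase hj'))
  let G : ℂ → ℂ := fun z => if z ∈ U then A z else B z
  have hGA : ∀ z ∈ closure U, G z = A z := by
    intro z hz
    by_cases hzU : z ∈ U
    · simp [G, hzU]
    · have hzK : z ∈ K := by
        by_contra hzK
        exact hzU (closure_comp hK hz hzK)
      simp only [G, hzU, if_false, A, B]
      rw [eq_div_iff (hprod z hz), hHK z hzK, he z hzK,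
        Finset.mul_prod_erase Finset.univ (fun i => (z - p i) ^ c i) (Finset.mem_univ _)]
  have hGB : ∀ z ∈ Uᶜ, G z = B z := fun z hz => if_neg hz
  have hA : ContinuousOn A (closure U) := by
    refine ContinuousOn.div (by fun_prop) ?_ hprod
    refine continuousOn_finsetProd _ fun j hj' => ?_
    exact ContinuousOn.zpow₀ (by fun_prop) _ fun z hz =>
      Or.inl (hcl z hz j (Finset.ne_of_mem_erase hj'))
  have hBne : ∀ z ∈ Uᶜ, z - p i₀ ≠ 0 := fun z hz h0 => hz (by rwa [sub_eq_zero.1 h0])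
  have hB : ContinuousOn B Uᶜ :=
    ContinuousOn.zpow₀ (by fun_prop) _ fun z hz => Or.inl (hBne z hz)
  have hG : Continuous G := by
    rw [← continuousOn_univ]
    have : (univ : Set ℂ) = closure U ∪ Uᶜ := by
      refine (eq_univ_of_forall fun z => ?_).symm
      by_cases hz : z ∈ U
      · exact Or.inl (subset_closure hz)
      · exact Or.inr hz
    rw [this]
    exact (hA.congr hGA).union_of_isClosed (hB.congr hGB) isClosed_closure hUo.isClosed_compl
  have hG0 : ∀ z, G z ≠ 0 := by
    intro z
    by_cases hz : z ∈ U
    · rw [hGA z (subset_closure hz)]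
      exact div_ne_zero (Complex.exp_ne_zero _) (hprod z (subset_closure hz))
    · rw [hGB z hz]
      exact zpow_ne_zero _ (hBne z hz)
  obtain ⟨L, hL, hLe⟩ := entire_log hG hG0
  obtain ⟨R, hR⟩ := hb.subset_ball (p i₀)
  have hR0 : 0 < R := by
    have := hR hpU
    simpa using this
  refine winding_zero (p := p i₀) hR0 hL fun z hz => ?_
  rw [hLe, hGB z ?_]
  intro hzU
  have := hR hzU
  rw [mem_ball, dist_eq_norm] at this
  linarith

lemma unbounded_unique {K : Set ℂ} (hK : IsCompact K) {p q : ℂ}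
    (h1 : ¬ Bornology.IsBounded (connectedComponentIn Kᶜ p))
    (h2 : ¬ Bornology.IsBounded (connectedComponentIn Kᶜ q)) :
    connectedComponentIn Kᶜ p = connectedComponentIn Kᶜ q := by
  obtain ⟨R, hR0, hR⟩ := hK.isBounded.subset_ball_lt 0 0
  let V : Set ℂ := Complex.exp '' {z : ℂ | Real.log R < z.re}
  have hV : IsPreconnected V :=
    (convex_halfSpace_re_gt _).isPreconnected.image _ Complex.continuous_exp.continuousOn
  have hVm : ∀ z, R < ‖z‖ → z ∈ V := by
    intro z hz
    have : z ≠ 0 := norm_pos_iff.1 (hR0.trans hz)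
    refine ⟨Complex.log z, ?_, Complex.exp_log this⟩
    rw [mem_ofPred_eq, Complex.log_re]
    exact Real.log_lt_log hR0 hz
  have hVK : V ⊆ Kᶜ := by
    rintro _ ⟨w, hw, rfl⟩ hk
    have := hR hk
    rw [mem_ball_zero_iff, Complex.norm_exp] at this
    have h3 := (Real.log_lt_iff_lt_exp hR0).1 hw
    linarith
  have key : ∀ p, ¬ Bornology.IsBounded (connectedComponentIn Kᶜ p) →
      ∃ x ∈ V, x ∈ connectedComponentIn Kᶜ p := by
    intro p hp
    by_contra! hcon
    refine hp ((isBounded_closedBall (x := (0:ℂ)) (r := R)).subset fun x hx => ?_)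
    rw [mem_closedBall_zero_iff]
    by_contra! hlt
    exact hcon x (hVm x hlt) hx
  obtain ⟨x, hxV, hx⟩ := key p h1
  obtain ⟨y, hyV, hy⟩ := key q h2
  rw [connectedComponentIn_eq hx, connectedComponentIn_eq hy]
  exact connectedComponentIn_eq (hV.subset_connectedComponentIn hxV hVK hyV)

lemma log_outer {K : Set ℂ} {c p : ℂ} {a a' : ℝ} (haa : a < a') (hp : dist p c ≤ a) :
    HasContLog (K ∩ {z | a' ≤ dist z c}) (fun z => (z - p) / (z - c)) := by
  have ha : 0 ≤ a := dist_nonneg.trans hp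
  have hpos : ∀ z ∈ K ∩ {z | a' ≤ dist z c}, a < ‖z - c‖ := by
    rintro z ⟨-, hz⟩
    rw [← dist_eq_norm]
    exact lt_of_lt_of_le haa hz
  have hne : ∀ z ∈ K ∩ {z | a' ≤ dist z c}, z - c ≠ 0 := fun z hz =>
    norm_pos_iff.1 (ha.trans_lt (hpos z hz))
  obtain ⟨h, hc, he⟩ := hasContLog_near (K := K ∩ {z | a' ≤ dist z c})
    (fun z => (c - p) / (z - c))
    (continuousOn_const.div (by fun_prop) hne) (by
      intro z hz
      rw [norm_div, div_lt_one (ha.trans_lt (hpos z hz)), ← dist_eq_norm, dist_comm]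
      exact hp.trans_lt (hpos z hz))
  refine ⟨h, hc, fun z hz => ?_⟩
  have := hne z hz
  rw [he z hz]
  field_simp
  ring

lemma log_inner {K : Set ℂ} {c q : ℂ} {b b' : ℝ} (hbb : b' < b) (hq : b ≤ dist q c) :
    HasContLog (K ∩ {z | dist z c ≤ b'}) (fun z => z - q) := by
  have hlt : ∀ z ∈ K ∩ {z | dist z c ≤ b'}, ‖z - c‖ < ‖c - q‖ := by
    rintro z ⟨-, hz⟩
    rw [← dist_eq_norm, ← dist_eq_norm, dist_comm c q]
    exact (lt_of_le_of_lt hz hbb).trans_le hq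
  have hne : ∀ z ∈ K ∩ {z | dist z c ≤ b'}, c - q ≠ 0 := fun z hz =>
    norm_pos_iff.1 ((norm_nonneg _).trans_lt (hlt z hz))
  obtain ⟨h, hc, he⟩ := hasContLog_near (K := K ∩ {z | dist z c ≤ b'})
    (fun z => (z - c) / (c - q))
    (ContinuousOn.div (by fun_prop) (by fun_prop) hne) (by
      intro z hz
      rw [norm_div, div_lt_one ((norm_nonneg _).trans_lt (hlt z hz))]
      exact hlt z hz)
  refine ⟨fun z => h z + Complex.log (c - q), hc.add continuousOn_const, fun z hz => ?_⟩
  have := hne z hz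
  rw [Complex.exp_add, he z hz, Complex.exp_log this]
  field_simp
  ring

lemma core_indep {K : Set ℂ} (hK : IsClosed K) {ι κ : Type*} [Fintype ι] [Fintype κ]
    (hcard : Fintype.card ι + 1 < Fintype.card κ)
    {c : ℂ} {a a' m b' b : ℝ} (h1 : a < a') (h2 : a' ≤ m) (h3 : m ≤ b') (h4 : b' < b)
    (P : ι → Set ℂ) (hP : ∀ k, IsPreconnected (P k)) (hPK : ∀ k, P k ⊆ K)
    (hPA : ∀ k, ∀ z ∈ P k, a' ≤ dist z c ∧ dist z c ≤ b')
    (hcov : ∀ z ∈ K, dist z c = m → ∃ k, z ∈ P k)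
    (p q : κ → ℂ) (hp : ∀ i, p i ∉ K) (hpa : ∀ i, dist (p i) c ≤ a) (hqb : ∀ i, b ≤ dist (q i) c)
    (hpq : ∀ i, q i ∈ connectedComponentIn Kᶜ (p i))
    (hbd : ∀ i, Bornology.IsBounded (connectedComponentIn Kᶜ (p i)))
    (hdis : ∀ i j, j ≠ i → p j ∉ connectedComponentIn Kᶜ (p i)) : False := by
  have hV := fun i => log_outer (K := K) h1 (hpa i)
  have hU : ∀ i, HasContLog (K ∩ {z | dist z c ≤ b'}) (fun z => z - p i) := by
    intro i
    obtain ⟨h, hc, he⟩ := log_inner (K := K) h4 (hqb i)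
    obtain ⟨h', hc', he'⟩ := hasContLog_conn hK isPreconnected_connectedComponentIn
      (connectedComponentIn_subset Kᶜ (p i)) (mem_connectedComponentIn (hp i)) (hpq i)
    refine ⟨fun z => h z + h' z, hc.add (hc'.mono inter_subset_left), fun z hz => ?_⟩
    have hne : z - q i ≠ 0 := by
      have h0 : Complex.exp (h z) = z - q i := he z hz
      rw [← h0]; exact Complex.exp_ne_zero _
    rw [Complex.exp_add, he z hz, he' z hz.1]
    field_simp
  choose V hVc hVe using hV
  choose U hUc hUe using hU
  obtain ⟨i0⟩ : Nonempty κ := Fintype.card_pos_iff.1 (by omega)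
  have hPU : ∀ k, P k ⊆ K ∩ {z | dist z c ≤ b'} := fun k z hz => ⟨hPK k hz, (hPA k z hz).2⟩
  have hPV : ∀ k, P k ⊆ K ∩ {z | a' ≤ dist z c} := fun k z hz => ⟨hPK k hz, (hPA k z hz).1⟩
  have hpne : ∀ i, ∀ z ∈ K, z - p i ≠ 0 := fun i z hz h => hp i (by rwa [← sub_eq_zero.1 h])
  have hn : ∀ i k, ∃ n : ℤ, ∀ z ∈ P k, (U i z - V i z) - (U i0 z - V i0 z) =
      n * (2 * Real.pi * Complex.I) := by
    intro i k
    refine exp_one_const (hP k) ?_ ?_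
    · exact (((hUc i).mono (hPU k)).sub ((hVc i).mono (hPV k))).sub
        (((hUc i0).mono (hPU k)).sub ((hVc i0).mono (hPV k)))
    · intro z hz
      have e1 := hpne i z (hPK k hz)
      have e2 := hpne i0 z (hPK k hz)
      have e3 : z - c ≠ 0 := by
        intro h
        have : Complex.exp (V i z) = (z - p i) / (z - c) := hVe i z (hPV k hz)
        rw [h, div_zero] at this
        exact Complex.exp_ne_zero _ this
      rw [Complex.exp_sub, Complex.exp_sub, Complex.exp_sub, hUe i z (hPU k hz),
        hVe i z (hPV k hz), hUe i0 z (hPU k hz), hVe i0 z (hPV k hz)]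
      field_simp
  choose n hn using hn
  let v : κ → (Option ι → ℤ) := fun i o => o.elim 1 (n i)
  have hli : ¬ LinearIndependent ℤ v := by
    intro h
    have := h.fintype_card_le_finrank
    simp at this
    omega
  obtain ⟨g, hg, i, hi⟩ := Fintype.not_linearIndependent_iff.1 hli
  have hg0 : ∑ i, g i = 0 := by
    have := congrFun hg none
    simpa [v, Finset.sum_apply] using this
  have hgk : ∀ k, ∑ i, g i * n i k = 0 := by
    intro k
    have := congrFun hg (some k)
    simpa [v, Finset.sum_apply] using this
  have hglue : ∀ z ∈ K, dist z c = m → ∑ i, (g i : ℂ) * U i z = ∑ i, (g i : ℂ) * V i z := by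
    intro z hz hzm
    obtain ⟨k, hk⟩ := hcov z hz hzm
    rw [← sub_eq_zero, ← Finset.sum_sub_distrib]
    have : ∀ i, (g i : ℂ) * U i z - g i * V i z =
        g i * (U i0 z - V i0 z) + ((g i * n i k : ℤ) : ℂ) * (2 * Real.pi * Complex.I) := by
      intro i
      have := hn i k z hk
      push_cast
      linear_combination (g i : ℂ) * this
    simp_rw [this]
    rw [Finset.sum_add_distrib, ← Finset.sum_mul, ← Finset.sum_mul, ← Int.cast_sum, ← Int.cast_sum,
      hgk, hg0]
    simp
  refine hi (eilenberg hK p g hp i (hbd i) (fun j hj => hdis i j hj) ?_)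
  classical
  let W : ℂ → ℂ := fun z => if dist z c ≤ m then ∑ i, (g i : ℂ) * U i z else ∑ i, (g i : ℂ) * V i z
  have hWU : ∀ z ∈ K ∩ {z | dist z c ≤ m}, W z = ∑ i, (g i : ℂ) * U i z := fun z hz => if_pos hz.2
  have hWV : ∀ z ∈ K ∩ {z | m ≤ dist z c}, W z = ∑ i, (g i : ℂ) * V i z := by
    rintro z ⟨hz, hzm⟩
    by_cases h : dist z c ≤ m
    · rw [hWU z ⟨hz, h⟩]
      exact hglue z hz (le_antisymm h hzm)
    · exact if_neg h
  have hsU : K ∩ {z | dist z c ≤ m} ⊆ K ∩ {z | dist z c ≤ b'} :=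
    fun z hz => ⟨hz.1, le_trans hz.2 h3⟩
  have hsV : K ∩ {z | m ≤ dist z c} ⊆ K ∩ {z | a' ≤ dist z c} :=
    fun z hz => ⟨hz.1, le_trans h2 hz.2⟩
  have hKe : K = (K ∩ {z | dist z c ≤ m}) ∪ (K ∩ {z | m ≤ dist z c}) := by
    rw [← inter_union_distrib_left, eq_comm, inter_eq_left]
    intro z _
    exact le_total (dist z c) m
  refine ⟨W, ?_, fun z hz => ?_⟩
  · rw [hKe]
    refine ContinuousOn.union_of_isClosed ?_ ?_ ?_ ?_
    · refine ContinuousOn.congr ?_ hWU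
      exact continuousOn_finsetSum _ fun i _ => continuousOn_const.mul ((hUc i).mono hsU)
    · refine ContinuousOn.congr ?_ hWV
      exact continuousOn_finsetSum _ fun i _ => continuousOn_const.mul ((hVc i).mono hsV)
    · exact hK.inter (isClosed_le (by fun_prop) (by fun_prop))
    · exact hK.inter (isClosed_le (by fun_prop) (by fun_prop))
  · rcases le_total (dist z c) m with h | h
    · rw [hWU z ⟨hz, h⟩, Complex.exp_sum]
      refine Finset.prod_congr rfl fun i _ => ?_
      rw [Complex.exp_int_mul, hUe i z (hsU ⟨hz, h⟩)]
    · rw [hWV z ⟨hz, h⟩, Complex.exp_sum]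
      have e3 : z - c ≠ 0 := by
        intro h'
        have : Complex.exp (V i z) = (z - p i) / (z - c) := hVe i z (hsV ⟨hz, h⟩)
        rw [h', div_zero] at this
        exact Complex.exp_ne_zero _ this
      have : ∀ i, Complex.exp (g i * V i z) = (z - p i) ^ g i * ((z - c) ^ g i)⁻¹ := by
        intro i
        rw [Complex.exp_int_mul, hVe i z (hsV ⟨hz, h⟩), div_zpow, div_eq_mul_inv]
      simp_rw [this]
      rw [Finset.prod_mul_distrib, Finset.prod_inv_distrib]
      have hz1 : ∀ s : Finset κ, ∏ i ∈ s, (z - c) ^ g i = (z - c) ^ (∑ i ∈ s, g i) := by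
        intro s
        induction s using Finset.induction_on with
        | empty => simp
        | insert x s hx ih => rw [Finset.prod_insert hx, Finset.sum_insert hx, ih, zpow_add₀ e3]
      rw [hz1, hg0]
      simp

lemma exists_pieces {γ : ℝ → ℂ} (hγ : ContinuousOn γ (Icc 0 1)) {c : ℂ} {a' m b' : ℝ}
    (h2 : a' < m) (h3 : m < b') :
    ∃ (T : Finset ℝ) (P : T → Set ℂ), (∀ k, IsPreconnected (P k)) ∧
      (∀ k, P k ⊆ γ '' Icc 0 1) ∧ (∀ k, ∀ z ∈ P k, a' ≤ dist z c ∧ dist z c ≤ b') ∧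
      (∀ z ∈ γ '' Icc 0 1, dist z c = m → ∃ k, z ∈ P k) := by
  have hd : ContinuousOn (fun t => dist (γ t) c) (Icc 0 1) :=
    (continuous_id.dist continuous_const).comp_continuousOn hγ
  let S : Set ℝ := Icc 0 1 ∩ (fun t => dist (γ t) c) ⁻¹' {m}
  have hS : IsCompact S := by
    refine isCompact_Icc.of_isClosed_subset ?_ inter_subset_left
    exact hd.preimage_isClosed_of_isClosed isClosed_Icc isClosed_singleton
  have hloc : ∀ t ∈ S, ∃ δ > 0, ∀ s ∈ ball t δ ∩ Icc 0 1, a' ≤ dist (γ s) c ∧ dist (γ s) c ≤ b' := by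
    rintro t ⟨ht, htm⟩
    have hc : ContinuousWithinAt (fun t => dist (γ t) c) (Icc 0 1) t :=
      hd t ht
    have : Icc a' b' ∈ nhds (dist (γ t) c) := by
      have : dist (γ t) c = m := htm
      rw [this]
      exact Icc_mem_nhds h2 h3
    have := hc this
    rw [Filter.mem_map, Metric.mem_nhdsWithin_iff] at this
    obtain ⟨δ, hδ, h⟩ := this
    exact ⟨δ, hδ, fun s hs => h hs⟩
  choose! δ hδ hδP using hloc
  obtain ⟨T, hTS, hT⟩ := hS.elim_nhds_subcover (fun t => ball t (δ t))
    (fun t ht => ball_mem_nhds _ (hδ t ht))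
  refine ⟨T, fun k => γ '' (ball k (δ k) ∩ Icc 0 1), ?_, ?_, ?_, ?_⟩
  · intro k
    refine IsPreconnected.image ?_ _ (hγ.mono inter_subset_right)
    exact ((convex_ball _ _).inter (convex_Icc _ _)).isPreconnected
  · intro k
    exact image_mono inter_subset_right
  · rintro k _ ⟨s, hs, rfl⟩
    exact hδP k (hTS k k.2) s hs
  · rintro _ ⟨t, ht, rfl⟩ htm
    obtain ⟨k, hk, hk'⟩ := mem_iUnion₂.1 (hT (show t ∈ S from ⟨ht, htm⟩))
    exact ⟨⟨k, hk⟩, t, ⟨hk', ht⟩, rfl⟩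

lemma core_concentric {γ : ℝ → ℂ} (hγ : ContinuousOn γ (Icc 0 1)) {c : ℂ} {a b : ℝ} (hab : a < b) :
    Set.Finite {F : Set ℂ |
      (∃ z ∈ (γ '' Icc 0 1)ᶜ, F = connectedComponentIn ((γ '' Icc 0 1)ᶜ) z) ∧
      (∃ p ∈ F, dist p c ≤ a) ∧ (∃ q ∈ F, b ≤ dist q c)} := by
  set K := γ '' Icc 0 1 with hKdef
  have hK : IsCompact K := isCompact_Icc.image_of_continuousOn hγ
  obtain ⟨T, P, hP, hPK, hPA, hcov⟩ := exists_pieces hγ (c := c)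
    (a' := (3 * a + b) / 4) (m := (a + b) / 2) (b' := (a + 3 * b) / 4) (by linarith) (by linarith)
  set S := {F : Set ℂ | (∃ z ∈ Kᶜ, F = connectedComponentIn Kᶜ z) ∧
      (∃ p ∈ F, dist p c ≤ a) ∧ (∃ q ∈ F, b ≤ dist q c)} with hS
  by_contra hinf
  have hub : {F ∈ S | ¬ Bornology.IsBounded F}.Subsingleton := by
    rintro _ ⟨⟨⟨z, -, rfl⟩, -⟩, h⟩ _ ⟨⟨⟨w, -, rfl⟩, -⟩, h'⟩
    exact unbounded_unique hK h h'
  have hinf' : {F ∈ S | Bornology.IsBounded F}.Infinite := by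
    intro hfin
    refine hinf ((hfin.union hub.finite).subset fun F hF => ?_)
    by_cases h : Bornology.IsBounded F
    · exact Or.inl ⟨hF, h⟩
    · exact Or.inr ⟨hF, h⟩
  obtain ⟨Q, hQ, hQc⟩ := hinf'.exists_subset_card_eq (Fintype.card T + 2)
  have hex : ∀ F : Q, ∃ p q : ℂ, p ∉ K ∧ (F : Set ℂ) = connectedComponentIn Kᶜ p ∧
      q ∈ (F : Set ℂ) ∧ dist p c ≤ a ∧ b ≤ dist q c := by
    intro F
    obtain ⟨⟨⟨z, hz, hFz⟩, ⟨p, hp, hpa⟩, ⟨q, hq, hqb⟩⟩, -⟩ := hQ F.2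
    refine ⟨p, q, ?_, ?_, hq, hpa, hqb⟩
    · rw [hFz] at hp
      exact connectedComponentIn_subset _ _ hp
    · rw [hFz] at hp ⊢
      exact connectedComponentIn_eq hp
  choose p q hpK hF hq hpa hqb using hex
  refine core_indep (κ := Q) hK.isClosed (by rw [Fintype.card_coe Q, hQc]; omega)
    (by linarith) (by linarith) (by linarith) (by linarith) P hP hPK hPA hcov p q hpK hpa hqb
    (fun i => by rw [← hF i]; exact hq i) (fun i => by rw [← hF i]; exact (hQ i.2).2) ?_
  intro i j hji hj
  refine hji (Subtype.ext ?_)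
  rw [hF i, hF j]
  exact (connectedComponentIn_eq hj).symm

/-- If `E₁` and `E₂` are disjoint circles in `ℂ` and `γ : [0,1] → ℂ` is a
continuous path, then only finitely many connected components of the complement of the
image of `γ` intersect both `E₁` and `E₂`. -/
theorem finitely_many_components_meeting_two_circles
    (c₁ c₂ : ℂ) (r₁ r₂ : ℝ) (hr₁ : 0 < r₁) (hr₂ : 0 < r₂)
    (hdisj : sphere c₁ r₁ ∩ sphere c₂ r₂ = ∅)
    (γ : ℝ → ℂ) (hγ : ContinuousOn γ (Icc 0 1)) :
    Set.Finite {F : Set ℂ |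
      (∃ z ∈ (γ '' Icc 0 1)ᶜ, F = connectedComponentIn ((γ '' Icc 0 1)ᶜ) z) ∧
      (F ∩ sphere c₁ r₁).Nonempty ∧ (F ∩ sphere c₂ r₂).Nonempty} := by
  have hconn : IsConnected (sphere c₂ r₂) :=
    isConnected_sphere (by rw [Complex.rank_real_complex]; norm_num) c₂ hr₂.le
  have hcomp : IsCompact (sphere c₂ r₂) := isCompact_sphere c₂ r₂
  have hcont : ContinuousOn (fun z => dist z c₁) (sphere c₂ r₂) := by fun_prop
  obtain ⟨x, hx, hxmin⟩ := hcomp.exists_isMinOn hconn.nonempty hcont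
  obtain ⟨y, hy, hymax⟩ := hcomp.exists_isMaxOn hconn.nonempty hcont
  have hne : ∀ z ∈ sphere c₂ r₂, dist z c₁ ≠ r₁ := by
    intro z hz h
    have : z ∈ sphere c₁ r₁ ∩ sphere c₂ r₂ := ⟨h, hz⟩
    rw [hdisj] at this
    exact this
  rcases lt_or_gt_of_ne (hne x hx) with hlt | hgt
  · have hylt : dist y c₁ < r₁ := by
      by_contra! hle
      obtain ⟨z, hz, hze⟩ := hconn.isPreconnected.intermediate_value hx hy hcont ⟨hlt.le, hle⟩
      exact hne z hz hze
    refine (core_concentric hγ (c := c₁) hylt).subset ?_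
    rintro F ⟨hF, ⟨q, hq, hq1⟩, ⟨p, hp, hp2⟩⟩
    exact ⟨hF, ⟨p, hp, hymax hp2⟩, ⟨q, hq, (mem_sphere.1 hq1).ge⟩⟩
  · refine (core_concentric hγ (c := c₁) hgt).subset ?_
    rintro F ⟨hF, ⟨p, hp, hp1⟩, ⟨q, hq, hq2⟩⟩
    exact ⟨hF, ⟨p, hp, (mem_sphere.1 hp1).le⟩, ⟨q, hq, hxmin hq2⟩⟩
end

section
/- Let $g(z)=e^{\frac{z+1}{z-1}}$ on the open unit disk $\mathbb{D}$, and let $\gamma$ be a path in the disk from $-1$ to $1$. If the limit $L=\lim_{s\to 1^-} g(\gamma(s))$ exists in $\mathbb{C}$, then $L=0$. -/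
open Set Metric Filter

/-- If `g z = exp ((z+1)/(z-1))` converges along a path `γ` in the disk
from `-1` to `1`, then the limit is `0`. -/
theorem limit_of_g_along_path_is_zero
    (γ : ℝ → ℂ)
    (hγc : ContinuousOn γ (Icc 0 1)) (hγ0 : γ 0 = -1) (hγ1 : γ 1 = 1)
    (hγD : ∀ s ∈ Ioo (0:ℝ) 1, γ s ∈ ball (0:ℂ) 1)
    (L : ℂ)
    (hL : Tendsto (fun s => Complex.exp ((γ s + 1) / (γ s - 1)))
      (nhdsWithin 1 (Iio 1)) (nhds L)) :
    L = 0 := by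
  by_contra hL0
  have hne : ∀ s ∈ Ioo (0:ℝ) 1, γ s - 1 ≠ 0 := by
    intro s hs h
    have h1 := hγD s hs
    rw [sub_eq_zero.1 h] at h1
    simp at h1
  set w : ℝ → ℂ := fun s => (γ s + 1) / (γ s - 1) with hw
  have hwc : ContinuousOn w (Ioo 0 1) := by
    have h := hγc.mono Ioo_subset_Icc_self
    exact (h.add continuousOn_const).div (h.sub continuousOn_const) hne
  have hev : ∀ᶠ s in nhdsWithin (1:ℝ) (Iio 1), s ∈ Ioo (0:ℝ) 1 :=
    Ioo_mem_nhdsLT (by norm_num)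
  have hγt : Tendsto γ (nhdsWithin (1:ℝ) (Iio 1)) (nhds 1) := by
    have h := hγc 1 (by simp)
    rw [ContinuousWithinAt, hγ1] at h
    refine h.mono_left ?_
    rw [nhdsWithin_le_iff]
    filter_upwards [hev] with s hs using Ioo_subset_Icc_self hs
  have hf : Tendsto (fun s => Complex.exp (w s) / L) (nhdsWithin 1 (Iio 1)) (nhds 1) := by
    have := hL.div_const L
    rwa [div_self hL0] at this
  have hslit : ∀ᶠ s in nhdsWithin (1:ℝ) (Iio 1),
      Complex.exp (w s) / L ∈ Complex.slitPlane :=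
    hf.eventually (Complex.isOpen_slitPlane.mem_nhds Complex.one_mem_slitPlane)
  obtain ⟨a, ha, hsub⟩ := (mem_nhdsLT_iff_exists_Ioo_subset).1 (hev.and hslit)
  have ha1 : a < 1 := ha
  set h : ℝ → ℂ := fun s => w s - Complex.log (Complex.exp (w s) / L) with hh
  have hhc : ContinuousOn h (Ioo a 1) := by
    have hwa := hwc.mono (fun s hs => (hsub hs).1)
    exact hwa.sub (((hwa.cexp).div_const L).clog (fun s hs => (hsub hs).2))
  have hexp : ∀ s, Complex.exp (h s) = L := by
    intro s
    rw [hh]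
    simp only
    rw [Complex.exp_sub, Complex.exp_log (div_ne_zero (Complex.exp_ne_zero _) hL0)]
    field_simp
  obtain ⟨b, hb⟩ : (Ioo a 1).Nonempty := nonempty_Ioo.2 ha1
  have hint : ∀ s, ∃ n : ℤ, h s - h b = n * (2 * Real.pi * Complex.I) := by
    intro s
    rw [← Complex.exp_eq_one_iff, Complex.exp_sub, hexp, hexp, div_self hL0]
  choose n hn using hint
  have hnc : ContinuousOn n (Ioo a 1) := by
    rw [Int.isClosedEmbedding_coe_real.isInducing.continuousOn_iff]
    have : ((fun m : ℤ => (m:ℝ)) ∘ n) = fun s => (h s - h b).im / (2 * Real.pi) := by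
      funext s
      rw [hn]
      have := Real.pi_ne_zero
      simp
    rw [this]
    exact (Complex.continuous_im.comp_continuousOn (hhc.sub continuousOn_const)).div_const _
  have hconst : ∀ s ∈ Ioo a 1, h s = h b := by
    intro s hs
    have e : n s = n b := isPreconnected_Ioo.constant hnc hs hb
    have h1 := hn s
    rw [e, ← hn b, sub_self] at h1
    exact sub_eq_zero.1 h1
  have hlog : Tendsto (fun s => Complex.log (Complex.exp (w s) / L))
      (nhdsWithin 1 (Iio 1)) (nhds 0) := by
    have := hf.clog Complex.one_mem_slitPlane
    rwa [Complex.log_one] at this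
  have hwt : Tendsto w (nhdsWithin 1 (Iio 1)) (nhds (h b + 0)) := by
    refine (tendsto_const_nhds.add hlog).congr' ?_
    filter_upwards [Ioo_mem_nhdsLT ha1] with s hs
    rw [← hconst s hs, hh]
    ring
  have hprod := hwt.mul (hγt.sub_const 1)
  have h2 : Tendsto (fun s => γ s + 1) (nhdsWithin (1:ℝ) (Iio 1)) (nhds (1 + 1)) :=
    hγt.add_const 1
  have h3 : Tendsto (fun s => γ s + 1) (nhdsWithin (1:ℝ) (Iio 1))
      (nhds ((h b + 0) * (1 - 1))) := by
    refine hprod.congr' ?_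
    filter_upwards [hev] with s hs
    exact div_mul_cancel₀ _ (hne s hs)
  have h4 := tendsto_nhds_unique h2 h3
  norm_num at h4
end
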